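/- Let K be a field of characteristic p with [K : K^p] = p^δ. Then for every finite purely inseparable extension L/K and every integer q ≥ δ, the Milnor K-theory norm map N_{L/K} : K_q^M(L) → K_q^M(K) is surjective. -/

import Mathlib

open scoped TensorProduct

/-- The Steinberg subgroup of the `q`-fold tensor power of `Fˣ`: the subgroup generated by
elementary tensors `a₁ ⊗ ⋯ ⊗ a_q` with `a_i + a_j = 1` for some `i ≠ j`. -/
noncomputable def SteinbergSubgroup (F : Type*) [Field F] (q : ℕ) :
    AddSubgroup (⨂[ℤ] (_ : Fin q), Additive Fˣ) :=
  AddSubgroup.closure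
    {z | ∃ a : Fin q → Fˣ, (∃ i j, i ≠ j ∧ ((a i : F) + (a j : F) = 1)) ∧
      z = PiTensorProduct.tprod ℤ (fun i => Additive.ofMul (a i))}

/-- The `q`-th Milnor K-group of a field `F`: the quotient of the `q`-fold tensor power
(over `ℤ`) of `Fˣ` by the Steinberg relations. -/
noncomputable def MilnorK (F : Type*) [Field F] (q : ℕ) : Type _ :=
  (⨂[ℤ] (_ : Fin q), Additive Fˣ) ⧸ SteinbergSubgroup F q

noncomputable instance (F : Type*) [Field F] (q : ℕ) : AddCommGroup (MilnorK F q) :=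
  inferInstanceAs (AddCommGroup ((⨂[ℤ] (_ : Fin q), Additive Fˣ) ⧸ SteinbergSubgroup F q))

/-- The symbol `{a₁, …, a_q}` in the Milnor K-group. -/
noncomputable def MilnorK.symbol {F : Type*} [Field F] {q : ℕ} (a : Fin q → Fˣ) : MilnorK F q :=
  QuotientAddGroup.mk (PiTensorProduct.tprod ℤ (fun i => Additive.ofMul (a i)))

/-- Functoriality of Milnor K-groups: the restriction map along a field embedding. -/
noncomputable def MilnorK.map {F F' : Type*} [Field F] [Field F'] (φ : F →+* F') (q : ℕ) :
    MilnorK F q →+ MilnorK F' q :=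
  QuotientAddGroup.map _ _
    ((PiTensorProduct.map (fun _ =>
      (AddMonoidHom.toIntLinearMap
        (MonoidHom.toAdditive (Units.map (φ : F →* F')))))).toAddMonoidHom) <| by
      rw [SteinbergSubgroup, ← AddSubgroup.map_le_iff_le_comap, AddMonoidHom.map_closure]
      apply AddSubgroup.closure_mono
      rintro _ ⟨z, ⟨a, ⟨i, j, hij, hsum⟩, rfl⟩, rfl⟩
      refine ⟨fun i => Units.map (φ : F →* F') (a i), ⟨i, j, hij, ?_⟩, ?_⟩
      · simpa using congrArg φ hsum
      · rw [LinearMap.toAddMonoidHom_coe, PiTensorProduct.map_tprod]; rfl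

open Function Polynomial
open scoped LaurentSeries

universe u

/-- Additive form of the map induced on units by a homomorphism of fields. -/
def unitsAddMap {F F' : Type*} [Field F] [Field F'] (φ : F →+* F') :
    Additive Fˣ →ₗ[ℤ] Additive F'ˣ :=
  (MonoidHom.toAdditive (Units.map (φ : F →* F'))).toIntLinearMap

@[simp]
theorem coe_unitsAddMap {F F' : Type*} [Field F] [Field F'] (φ : F →+* F') (x : Additive Fˣ) :
    ((unitsAddMap φ x).toMul : F') = φ x.toMul := rfl

theorem additiveUnits_ext {F : Type*} [Field F] {x y : Additive Fˣ}
    (h : (x.toMul : F) = y.toMul) : x = y :=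
  Additive.toMul.injective (Units.ext h)

theorem MilnorK.map_tprod {F F' : Type*} [Field F] [Field F'] (φ : F →+* F') {q : ℕ}
    (a : Fin q → Additive Fˣ) :
    MilnorK.map φ q (QuotientAddGroup.mk' (SteinbergSubgroup F q) (PiTensorProduct.tprod ℤ a)) =
      QuotientAddGroup.mk' (SteinbergSubgroup F' q)
        (PiTensorProduct.tprod ℤ fun i => unitsAddMap φ (a i)) :=
  congrArg (QuotientAddGroup.mk' (SteinbergSubgroup F' q))
    (PiTensorProduct.map_tprod (fun _ : Fin q => unitsAddMap φ) a)

/-- The Milnor K-group modulo `p`. -/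
def MilnorKMod (p : ℕ) (F : Type*) [Field F] (q : ℕ) : Type _ :=
  MilnorK F q ⧸ (nsmulAddMonoidHom p : MilnorK F q →+ MilnorK F q).range

namespace MilnorKMod

noncomputable instance (p : ℕ) (F : Type*) [Field F] (q : ℕ) : AddCommGroup (MilnorKMod p F q) :=
  QuotientAddGroup.Quotient.addCommGroup
    (nsmulAddMonoidHom p : MilnorK F q →+ MilnorK F q).range

section Basic

variable (p : ℕ) {F F' : Type*} [Field F] [Field F'] {q : ℕ}

/-- The projection from the Milnor K-group to its quotient modulo `p`. -/
noncomputable def mk : MilnorK F q →+ MilnorKMod p F q :=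
  QuotientAddGroup.mk' (nsmulAddMonoidHom p : MilnorK F q →+ MilnorK F q).range

variable {p} in
theorem mk_eq_zero_iff {x : MilnorK F q} : mk p x = 0 ↔ ∃ y, x = p • y := by
  refine (QuotientAddGroup.eq_zero_iff x).trans ?_
  simp [AddMonoidHom.mem_range, eq_comm]

theorem nsmul_eq_zero (x : MilnorKMod p F q) : p • x = 0 := by
  obtain ⟨x, rfl⟩ := QuotientAddGroup.mk_surjective x
  exact (mk_eq_zero_iff (p := p) (x := p • x)).2 ⟨x, rfl⟩

/-- Symbols in Milnor K-theory modulo `p`, as a multilinear map. -/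
noncomputable def symbolMultilinear :
    MultilinearMap ℤ (fun _ : Fin q => Additive Fˣ) (MilnorKMod p F q) :=
  (((mk p).comp (QuotientAddGroup.mk' (SteinbergSubgroup F q))).toIntLinearMap).compMultilinearMap
    (PiTensorProduct.tprod ℤ)

theorem symbolMultilinear_eq_zero_of_add_eq_one (a : Fin q → Additive Fˣ) {i j : Fin q}
    (hij : i ≠ j) (h : ((a i).toMul : F) + (a j).toMul = 1) : symbolMultilinear p a = 0 := by
  have : (QuotientAddGroup.mk' (SteinbergSubgroup F q)) (PiTensorProduct.tprod ℤ a) = 0 :=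
    (QuotientAddGroup.eq_zero_iff _).2 <| AddSubgroup.subset_closure
      ⟨fun i => (a i).toMul, ⟨i, j, hij, h⟩, rfl⟩
  change mk p (QuotientAddGroup.mk' (SteinbergSubgroup F q) (PiTensorProduct.tprod ℤ a)) = 0
  rw [this]
  exact map_zero (mk p)

/-- The universal property of Milnor K-theory. -/
noncomputable def liftMilnorK {A : Type*} [AddCommGroup A]
    (s : MultilinearMap ℤ (fun _ : Fin q => Additive Fˣ) A)
    (hs : ∀ (a : Fin q → Additive Fˣ) (i j : Fin q), i ≠ j →
      ((a i).toMul : F) + (a j).toMul = 1 → s a = 0) : MilnorK F q →+ A :=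
  QuotientAddGroup.lift (SteinbergSubgroup F q) (PiTensorProduct.lift s).toAddMonoidHom <|
    (AddSubgroup.closure_le _).2 <| by
      rintro _ ⟨a, ⟨i, j, hij, h⟩, rfl⟩
      exact AddMonoidHom.mem_ker.2 <|
        (PiTensorProduct.lift.tprod (φ := s) _).trans (hs _ i j hij h)

/-- The universal property of Milnor K-theory modulo `p`. -/
noncomputable def lift {A : Type*} [AddCommGroup A]
    (s : MultilinearMap ℤ (fun _ : Fin q => Additive Fˣ) A) (hA : ∀ x : A, p • x = 0)
    (hs : ∀ (a : Fin q → Additive Fˣ) (i j : Fin q), i ≠ j →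
      ((a i).toMul : F) + (a j).toMul = 1 → s a = 0) :
    MilnorKMod p F q →+ A :=
  QuotientAddGroup.lift _ (liftMilnorK s hs) <| by
    rintro _ ⟨x, rfl⟩
    exact AddMonoidHom.mem_ker.2 ((map_nsmul _ _ _).trans (hA _))

@[simp]
theorem lift_symbolMultilinear {A : Type*} [AddCommGroup A]
    (s : MultilinearMap ℤ (fun _ : Fin q => Additive Fˣ) A) (hA : ∀ x : A, p • x = 0) (hs)
    (a : Fin q → Additive Fˣ) : lift p s hA hs (symbolMultilinear p a) = s a :=
  PiTensorProduct.lift.tprod (φ := s) a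

variable {p} in
theorem addHom_ext {A : Type*} [AddCommGroup A] {f g : MilnorKMod p F q →+ A}
    (h : ∀ a, f (symbolMultilinear p a) = g (symbolMultilinear p a)) : f = g := by
  refine QuotientAddGroup.addMonoidHom_ext _ (QuotientAddGroup.addMonoidHom_ext _ ?_)
  refine AddMonoidHom.toIntLinearMap_injective
    (PiTensorProduct.ext (MultilinearMap.ext fun a => ?_))
  exact h a

/-- Functoriality of Milnor K-theory modulo `p`. -/
noncomputable def map (φ : F →+* F') (q : ℕ) : MilnorKMod p F q →+ MilnorKMod p F' q :=
  lift p ((symbolMultilinear p).compLinearMap fun _ => unitsAddMap φ) (nsmul_eq_zero p)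
    fun a i j hij h => symbolMultilinear_eq_zero_of_add_eq_one p _ hij <| by
      simpa using congrArg φ h

@[simp]
theorem map_symbolMultilinear (φ : F →+* F') (a : Fin q → Additive Fˣ) :
    map p φ q (symbolMultilinear p a) = symbolMultilinear p fun i => unitsAddMap φ (a i) :=
  lift_symbolMultilinear ..

theorem map_mk (φ : F →+* F') (x : MilnorK F q) :
    map p φ q (mk p x) = mk p (MilnorK.map φ q x) := by
  suffices (map p φ q).comp (mk p) = (mk p).comp (MilnorK.map φ q) from
    DFunLike.congr_fun this x
  refine QuotientAddGroup.addMonoidHom_ext _ ?_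
  refine AddMonoidHom.toIntLinearMap_injective
    (PiTensorProduct.ext (MultilinearMap.ext fun a => ?_))
  change map p φ q (symbolMultilinear p a) = mk p (MilnorK.map φ q (QuotientAddGroup.mk' _ _))
  rw [map_symbolMultilinear]
  exact congrArg (mk p) (MilnorK.map_tprod φ a).symm

@[simp]
theorem map_id (x : MilnorKMod p F q) : map p (RingHom.id F) q x = x := by
  suffices map p (RingHom.id F) q = AddMonoidHom.id _ from DFunLike.congr_fun this x
  refine addHom_ext fun a => ?_
  simp only [map_symbolMultilinear]
  rfl

end Basic

section Symbol

variable (p : ℕ) [Fact p.Prime] (F : Type*) [Field F] [CharP F p] (q : ℕ)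

/-- The class of `-1` in the additive group of units. -/
def negOne : Additive Fˣ := Additive.ofMul (-1)

variable {F q} in
theorem symbolMultilinear_update_negOne (a : Fin q → Additive Fˣ) (i : Fin q) :
    symbolMultilinear p (update a i (negOne F)) = 0 := by
  have h : negOne F = (p : ℤ) • negOne F := by
    refine additiveUnits_ext ?_
    rw [natCast_zsmul]
    have := neg_one_pow_char F p
    simpa [negOne] using this.symm
  rw [h, MultilinearMap.map_update_smul, natCast_zsmul, nsmul_eq_zero]

variable {F q} in
theorem symbolMultilinear_update_self_add_negOne (a : Fin q → Additive Fˣ) {i j : Fin q}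
    (hij : i ≠ j) : symbolMultilinear p (update a j (a i + negOne F)) = 0 := by
  obtain ⟨x, hx⟩ : ∃ x : Additive Fˣ, a i = x := ⟨_, rfl⟩
  by_cases h1 : (x.toMul : F) = 1
  · have : x = 0 := additiveUnits_ext h1
    rw [hx, this, zero_add, symbolMultilinear_update_negOne]
  have hxu : (x.toMul : F) ≠ 0 := x.toMul.ne_zero
  let u : Additive Fˣ := Additive.ofMul (Units.mk0 (1 - (x.toMul : F)) (sub_ne_zero.2 (Ne.symm h1)))
  let w : Additive Fˣ := Additive.ofMul (Units.mk0 (1 - (x.toMul : F)⁻¹)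
    (sub_ne_zero.2 fun h => h1 (by simpa using h.symm)))
  have huw : x + negOne F = u - w := by
    refine additiveUnits_ext ?_
    have h2 : (x.toMul : F) - 1 ≠ 0 := sub_ne_zero.2 h1
    simp only [negOne, u, w, toMul_add, toMul_ofMul, toMul_sub, Units.val_mul, Units.val_neg,
      Units.val_one, Units.val_div_eq_div_val, Units.val_mk0]
    field_simp
    ring
  have e1 : symbolMultilinear p (update a j u) = 0 :=
    symbolMultilinear_eq_zero_of_add_eq_one p _ hij (by simp [update_of_ne hij, hx, u])
  have e2 : symbolMultilinear p (update (update a j w) i (-x)) = 0 :=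
    symbolMultilinear_eq_zero_of_add_eq_one p _ hij (by simp [update_of_ne hij.symm, w])
  have e3 : update (update a j w) i x = update a j w := by
    rw [update_eq_self_iff, update_of_ne hij, hx]
  rw [show -x = (-1 : ℤ) • x by simp, MultilinearMap.map_update_smul, e3] at e2
  rw [hx, huw, MultilinearMap.map_update_sub, e1, zero_sub]
  simpa using e2

/-- Symbols in Milnor K-theory modulo the characteristic, as an alternating map. -/
noncomputable def symbol : (Additive Fˣ) [⋀^Fin q]→ₗ[ℤ] MilnorKMod p F q where
  toMultilinearMap := symbolMultilinear p
  map_eq_zero_of_eq' a i j h hij := by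
    have h1 := symbolMultilinear_update_self_add_negOne p a hij
    rw [MultilinearMap.map_update_add, symbolMultilinear_update_negOne, add_zero, h,
      update_eq_self] at h1
    exact h1

variable {F q}

theorem symbol_eq_symbolMultilinear (a : Fin q → Additive Fˣ) :
    symbol p F q a = symbolMultilinear p a := rfl

theorem symbol_eq_zero_of_add_eq_one (a : Fin q → Additive Fˣ) {i j : Fin q}
    (hij : i ≠ j) (h : ((a i).toMul : F) + (a j).toMul = 1) : symbol p F q a = 0 :=
  symbolMultilinear_eq_zero_of_add_eq_one p a hij h

theorem symbol_update_negOne (a : Fin q → Additive Fˣ) (i : Fin q) :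
    symbol p F q (update a i (negOne F)) = 0 :=
  symbolMultilinear_update_negOne p a i

theorem map_symbol {F' : Type*} [Field F'] [CharP F' p] (φ : F →+* F') (a : Fin q → Additive Fˣ) :
    map p φ q (symbol p F q a) = symbol p F' q fun i => unitsAddMap φ (a i) :=
  map_symbolMultilinear p φ a

/-- Inserting `x + y = z` into two slots: the relation `{z/x, y/x} = 0` up to signs. -/
theorem symbol_eq_zero_of_add_eq (a : Fin q → Additive Fˣ) {i j : Fin q} (hij : i ≠ j)
    {x y z : Additive Fˣ} (h : (x.toMul : F) + y.toMul = z.toMul) :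
    symbol p F q (update (update a i (x - z)) j (y - z)) = 0 := by
  refine symbol_eq_zero_of_add_eq_one p _ hij ?_
  have := z.toMul.ne_zero
  simp only [update_of_ne hij, update_self, toMul_sub, Units.val_div_eq_div_val]
  rw [← add_div, h, div_self this]

end Symbol

end MilnorKMod

section Laurent

variable {κ : Type*} [Field κ]

/-- The order of a nonzero Laurent series, as a homomorphism. -/
noncomputable def laurentOrder (κ : Type*) [Field κ] : Additive (κ⸨X⸩)ˣ →ₗ[ℤ] ℤ :=
  (AddMonoidHom.mk' (fun x => HahnSeries.order (x.toMul : κ⸨X⸩)) fun x y =>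
    HahnSeries.order_mul x.toMul.ne_zero y.toMul.ne_zero).toIntLinearMap

/-- The leading coefficient of a nonzero Laurent series, as a homomorphism. -/
noncomputable def laurentCoeff (κ : Type*) [Field κ] : Additive (κ⸨X⸩)ˣ →ₗ[ℤ] Additive κˣ :=
  (AddMonoidHom.mk' (fun x => Additive.ofMul (Units.mk0 (HahnSeries.leadingCoeff (x.toMul : κ⸨X⸩))
    (HahnSeries.leadingCoeff_ne_zero.2 x.toMul.ne_zero))) fun x y =>
      additiveUnits_ext (by exact HahnSeries.leadingCoeff_mul ..)).toIntLinearMap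

theorem laurentOrder_apply (x : Additive (κ⸨X⸩)ˣ) :
    laurentOrder κ x = HahnSeries.order (x.toMul : κ⸨X⸩) := rfl

theorem coe_laurentCoeff (x : Additive (κ⸨X⸩)ˣ) :
    ((laurentCoeff κ x).toMul : κ) = HahnSeries.leadingCoeff (x.toMul : κ⸨X⸩) := rfl

theorem laurent_of_coeff_zero_ne_zero {x : Additive (κ⸨X⸩)ˣ}
    (h : ∀ n < 0, (x.toMul : κ⸨X⸩).coeff n = 0) (h0 : (x.toMul : κ⸨X⸩).coeff 0 ≠ 0) :
    laurentOrder κ x = 0 ∧ ((laurentCoeff κ x).toMul : κ) = (x.toMul : κ⸨X⸩).coeff 0 := by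
  have h1 : laurentOrder κ x = 0 := by
    rw [laurentOrder_apply]
    refine le_antisymm (HahnSeries.order_le_of_coeff_ne_zero h0) (not_lt.1 fun hlt => ?_)
    exact HahnSeries.coeff_order_eq_zero.not.2 x.toMul.ne_zero (h _ hlt)
  refine ⟨h1, ?_⟩
  rw [laurentOrder_apply] at h1
  rw [coe_laurentCoeff, HahnSeries.leadingCoeff_eq, h1]

theorem laurent_of_eq_C_add {y : Additive (κ⸨X⸩)ˣ} {z : κ⸨X⸩} {c : κ} (hc : c ≠ 0)
    (hz : 0 < z.order) (h : (y.toMul : κ⸨X⸩) = HahnSeries.C c + z) :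
    laurentOrder κ y = 0 ∧ ((laurentCoeff κ y).toMul : κ) = c := by
  have hz0 (n : ℤ) (hn : n ≤ 0) : z.coeff n = 0 :=
    HahnSeries.coeff_eq_zero_of_lt_order (hn.trans_lt hz)
  have h0 : (y.toMul : κ⸨X⸩).coeff 0 = c := by simp [h, hz0]
  rw [← h0]
  refine laurent_of_coeff_zero_ne_zero (fun n hn => ?_) (by rwa [h0])
  simp [h, hz0 n hn.le, hn.ne]

/-- A criterion for an alternating map on the units of the field of Laurent series to satisfy the
Steinberg relation. -/
theorem laurent_steinberg {A : Type*} [AddCommGroup A] {n : ℕ}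
    (G : (Additive (κ⸨X⸩)ˣ) [⋀^Fin n]→ₗ[ℤ] A)
    (h1 : ∀ (a : Fin n → Additive (κ⸨X⸩)ˣ) (i : Fin n), laurentOrder κ (a i) = 0 →
      (((laurentCoeff κ (a i)).toMul : κ) = 1 ∨ ((laurentCoeff κ (a i)).toMul : κ) = -1) → G a = 0)
    (h2 : ∀ (a : Fin n → Additive (κ⸨X⸩)ˣ) (i j : Fin n), i ≠ j → laurentOrder κ (a i) = 0 →
      laurentOrder κ (a j) = 0 →
      ((laurentCoeff κ (a i)).toMul : κ) + (laurentCoeff κ (a j)).toMul = 1 → G a = 0)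
    (a : Fin n → Additive (κ⸨X⸩)ˣ) {i j : Fin n} (hij : i ≠ j)
    (h : ((a i).toMul : κ⸨X⸩) + (a j).toMul = 1) : G a = 0 := by
  have hpos {i j : Fin n} (h : ((a i).toMul : κ⸨X⸩) + (a j).toMul = 1)
      (hi : 0 < laurentOrder κ (a i)) : G a = 0 := by
    obtain ⟨h3, h4⟩ := laurent_of_eq_C_add (y := a j) one_ne_zero
      (by rwa [HahnSeries.order_neg, ← laurentOrder_apply])
      (by rw [map_one]; linear_combination h)
    exact h1 a j h3 (Or.inl h4)
  have hneg {i j : Fin n} (hij : i ≠ j) (h : ((a i).toMul : κ⸨X⸩) + (a j).toMul = 1)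
      (hi : laurentOrder κ (a i) < 0) : G a = 0 := by
    obtain ⟨h3, h4⟩ := laurent_of_eq_C_add (y := a j - a i) (c := -1)
      (z := ((-a i).toMul : κ⸨X⸩)) (by simp)
      (by rw [← laurentOrder_apply]; simpa using hi) <| by
        have := (a i).toMul.ne_zero
        simp only [toMul_sub, toMul_neg, Units.val_div_eq_div_val, Units.val_inv_eq_inv_val,
          map_neg, map_one]
        field_simp
        linear_combination h
    have h5 : G (update a j (a i)) = 0 :=
      G.map_eq_zero_of_eq _ (by simp [update_of_ne hij]) hij
    have h6 : G (update a j (a j - a i)) = 0 := h1 _ j (by rwa [update_self])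
      (by rw [update_self]; exact Or.inr h4)
    have := G.map_update_add a j (a i) (a j - a i)
    rwa [add_sub_cancel, update_eq_self, h5, h6, add_zero] at this
  rcases lt_trichotomy (laurentOrder κ (a i)) 0 with hi | hi | hi
  · exact hneg hij h hi
  · rcases lt_trichotomy (laurentOrder κ (a j)) 0 with hj | hj | hj
    · exact hneg hij.symm (by rwa [add_comm]) hj
    · refine h2 a i j hij hi hj ?_
      rw [laurentOrder_apply] at hi hj
      rw [coe_laurentCoeff, coe_laurentCoeff, HahnSeries.leadingCoeff_eq,
        HahnSeries.leadingCoeff_eq, hi, hj, ← HahnSeries.coeff_add, h]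
      simp
    · exact hpos (by rwa [add_comm]) hj
  · exact hpos h hi

end Laurent

namespace MilnorKMod

section Tame

variable (p : ℕ) [Fact p.Prime] (κ : Type*) [Field κ] [CharP κ p] (n : ℕ)

variable {κ n} in
theorem symbol_eq_zero_of_eq_one_or (a : Fin n → Additive κˣ) (i : Fin n)
    (h : ((a i).toMul : κ) = 1 ∨ ((a i).toMul : κ) = -1) : symbol p κ n a = 0 := by
  rcases h with h | h
  · exact (symbol p κ n).map_coord_zero i (additiveUnits_ext h)
  · have : a i = negOne κ := additiveUnits_ext h
    rw [← update_eq_self i a, this, symbol_update_negOne]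

/-- The alternating map underlying the tame symbol on Laurent series. -/
noncomputable def tameAlternating :
    (Additive (κ⸨X⸩)ˣ) [⋀^Fin (n + 1)]→ₗ[ℤ] MilnorKMod p κ n :=
  AlternatingMap.alternatizeUncurryFin
    ((laurentOrder κ).smulRight ((symbol p κ n).compLinearMap (laurentCoeff κ)))

theorem tameAlternating_apply (a : Fin (n + 1) → Additive (κ⸨X⸩)ˣ) :
    tameAlternating p κ n a = ∑ i : Fin (n + 1), (-1) ^ (i : ℕ) • laurentOrder κ (a i) •
      symbol p κ n fun k => laurentCoeff κ (a (i.succAbove k)) := by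
  rw [tameAlternating, AlternatingMap.alternatizeUncurryFin_apply]
  rfl

/-- The tame symbol on Milnor K-theory modulo the characteristic of the field of Laurent series. -/
noncomputable def tame : MilnorKMod p κ⸨X⸩ (n + 1) →+ MilnorKMod p κ n :=
  lift p (tameAlternating p κ n).toMultilinearMap (nsmul_eq_zero p) fun a i j hij h => by
    refine laurent_steinberg (tameAlternating p κ n) (fun a i hi h => ?_)
      (fun a i j hij hi hj h => ?_) a hij h
    · rw [tameAlternating_apply]
      refine Finset.sum_eq_zero fun k _ => ?_
      obtain rfl | hk := eq_or_ne i k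
      · rw [hi, zero_smul, smul_zero]
      · obtain ⟨l, rfl⟩ := Fin.exists_succAbove_eq hk
        rw [symbol_eq_zero_of_eq_one_or p _ l h, smul_zero, smul_zero]
    · rw [tameAlternating_apply]
      refine Finset.sum_eq_zero fun k _ => ?_
      obtain rfl | hk := eq_or_ne i k
      · rw [hi, zero_smul, smul_zero]
      obtain rfl | hk' := eq_or_ne j k
      · rw [hj, zero_smul, smul_zero]
      obtain ⟨l, rfl⟩ := Fin.exists_succAbove_eq hk
      obtain ⟨m, rfl⟩ := Fin.exists_succAbove_eq hk'
      rw [symbol_eq_zero_of_add_eq_one p _ (fun e => hij (congrArg _ e)) h, smul_zero, smul_zero]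

theorem tame_symbolMultilinear (a : Fin (n + 1) → Additive (κ⸨X⸩)ˣ) :
    tame p κ n (symbolMultilinear p a) = ∑ i : Fin (n + 1), (-1) ^ (i : ℕ) •
      laurentOrder κ (a i) • symbol p κ n fun k => laurentCoeff κ (a (i.succAbove k)) :=
  (lift_symbolMultilinear ..).trans (tameAlternating_apply p κ n a)

/-- The specialization map on Milnor K-theory modulo the characteristic of the field of Laurent
series. -/
noncomputable def specialize : MilnorKMod p κ⸨X⸩ n →+ MilnorKMod p κ n :=
  lift p ((symbol p κ n).compLinearMap (laurentCoeff κ)).toMultilinearMap (nsmul_eq_zero p)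
    fun a _ _ hij h =>
      laurent_steinberg ((symbol p κ n).compLinearMap (laurentCoeff κ))
        (fun _ i _ h => symbol_eq_zero_of_eq_one_or p _ i h)
        (fun _ _ _ hij _ _ h => symbol_eq_zero_of_add_eq_one p _ hij h) a hij h

theorem specialize_symbolMultilinear (a : Fin n → Additive (κ⸨X⸩)ˣ) :
    specialize p κ n (symbolMultilinear p a) = symbol p κ n fun k => laurentCoeff κ (a k) :=
  lift_symbolMultilinear ..

end Tame

end MilnorKMod

section Expansion

variable {F κ : Type*} [Field F] [Field κ] (φ : F →+* κ) (θ : κ)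

/-- Expansion of a polynomial as a power series around `θ`. -/
noncomputable def polyExpand : F[X] →+* κ⸨X⸩ :=
  (HahnSeries.ofPowerSeries ℤ κ).comp <| coeToPowerSeries.ringHom.comp <|
    (taylorAlgHom θ : κ[X] →+* κ[X]).comp (mapRingHom φ)

theorem polyExpand_injective : Injective (polyExpand φ θ) :=
  HahnSeries.ofPowerSeries_injective.comp <| (coe_injective κ).comp <|
    (taylor_injective θ).comp (map_injective φ φ.injective)

theorem coeff_polyExpand (g : F[X]) (n : ℤ) :
    (polyExpand φ θ g).coeff n = if n < 0 then 0 else (taylor θ (g.map φ)).coeff n.natAbs := by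
  refine (PowerSeries.coeff_coe _ n).trans ?_
  simp only [coeToPowerSeries.ringHom_apply, RingHom.comp_apply, Polynomial.coeff_coe]
  rfl

/-- Expansion of a rational function as a Laurent series around `θ`. -/
noncomputable def ratExpand : RatFunc F →+* κ⸨X⸩ :=
  IsFractionRing.lift (polyExpand_injective φ θ)

/-- The unit of the field of rational functions defined by a nonzero polynomial. -/
noncomputable def polyUnit (g : F[X]) (hg : g ≠ 0) : Additive (RatFunc F)ˣ :=
  Additive.ofMul (Units.mk0 (algebraMap F[X] (RatFunc F) g)
    ((map_ne_zero_iff _ (IsFractionRing.injective F[X] (RatFunc F))).2 hg))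

theorem coe_polyUnit (g : F[X]) (hg : g ≠ 0) :
    ((polyUnit g hg).toMul : RatFunc F) = algebraMap F[X] (RatFunc F) g := rfl

theorem coe_ratExpand_polyUnit (g : F[X]) (hg : g ≠ 0) :
    ((unitsAddMap (ratExpand φ θ) (polyUnit g hg)).toMul : κ⸨X⸩) = polyExpand φ θ g :=
  IsFractionRing.lift_algebraMap (polyExpand_injective φ θ) g

/-- The order of a rational function at `θ`. -/
noncomputable def ordAt : Additive (RatFunc F)ˣ →ₗ[ℤ] ℤ :=
  laurentOrder κ ∘ₗ unitsAddMap (ratExpand φ θ)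

/-- The leading coefficient of the expansion of a rational function at `θ`. -/
noncomputable def coeffAt : Additive (RatFunc F)ˣ →ₗ[ℤ] Additive κˣ :=
  laurentCoeff κ ∘ₗ unitsAddMap (ratExpand φ θ)

variable {φ θ}

theorem ordAt_polyUnit_of_eval₂_ne_zero {g : F[X]} (hg : g ≠ 0) (h : g.eval₂ φ θ ≠ 0) :
    ordAt φ θ (polyUnit g hg) = 0 ∧ ((coeffAt φ θ (polyUnit g hg)).toMul : κ) = g.eval₂ φ θ := by
  have h0 : (polyExpand φ θ g).coeff 0 = g.eval₂ φ θ := by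
    simp [coeff_polyExpand, taylor_coeff_zero, eval_map]
  have := laurent_of_coeff_zero_ne_zero (x := unitsAddMap (ratExpand φ θ) (polyUnit g hg))
  simp only [coe_ratExpand_polyUnit, h0] at this
  exact this (fun n hn => by simp [coeff_polyExpand, hn]) h

theorem ordAt_polyUnit_of_simple_root {g : F[X]} (hg : g ≠ 0) (h : g.eval₂ φ θ = 0)
    (h' : g.derivative.eval₂ φ θ ≠ 0) : ordAt φ θ (polyUnit g hg) = 1 := by
  change HahnSeries.order _ = _
  rw [coe_ratExpand_polyUnit]
  refine le_antisymm (HahnSeries.order_le_of_coeff_ne_zero ?_) (not_lt.1 fun hlt => ?_)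
  · simpa [coeff_polyExpand, taylor_coeff_one, derivative_map, eval_map] using h'
  · have h0 := HahnSeries.coeff_order_eq_zero.not.2
      ((map_ne_zero_iff _ (polyExpand_injective φ θ)).2 hg)
    refine h0 ?_
    rw [coeff_polyExpand]
    split_ifs with hn
    · rfl
    · rw [show (polyExpand φ θ g).order = 0 by lia]
      simpa [taylor_coeff_zero, eval_map] using h

theorem exists_coeffAt_polyUnit (g : F[X]) (hg : g ≠ 0) :
    ∃ n : ℕ, ((coeffAt φ θ (polyUnit g hg)).toMul : κ) = (taylor θ (g.map φ)).coeff n := by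
  have h : ((coeffAt φ θ (polyUnit g hg)).toMul : κ) =
      (polyExpand φ θ g).coeff (polyExpand φ θ g).order := by
    refine HahnSeries.leadingCoeff_eq.trans ?_
    rw [coe_ratExpand_polyUnit]
  have h0 := h ▸ (coeffAt φ θ (polyUnit g hg)).toMul.ne_zero
  rw [coeff_polyExpand] at h h0
  split_ifs at h h0 with hn
  · exact absurd rfl h0
  · exact ⟨_, h⟩

variable (φ θ)

theorem map_C_eq_polyUnit (x : Additive Fˣ) :
    unitsAddMap (RatFunc.C (K := F)) x = polyUnit (C (x.toMul : F)) (C_ne_zero.2 x.toMul.ne_zero) :=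
  additiveUnits_ext (RatFunc.algebraMap_C _).symm

theorem ordAt_C (x : Additive Fˣ) : ordAt φ θ (unitsAddMap (RatFunc.C (K := F)) x) = 0 := by
  rw [map_C_eq_polyUnit]
  exact (ordAt_polyUnit_of_eval₂_ne_zero _ (by simp)).1

theorem coeffAt_C (x : Additive Fˣ) :
    coeffAt φ θ (unitsAddMap (RatFunc.C (K := F)) x) = unitsAddMap φ x := by
  rw [map_C_eq_polyUnit]
  exact additiveUnits_ext
    ((ordAt_polyUnit_of_eval₂_ne_zero _ (by simp)).2.trans (by simp))

end Expansion

namespace MilnorKMod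

section Residue

variable (p : ℕ) [Fact p.Prime] {F κ : Type*} [Field F] [Field κ] [CharP F p] [CharP κ p]
  (φ : F →+* κ) (θ : κ) (n : ℕ)

/-- The residue map at `θ` on Milnor K-theory modulo `p` of the field of rational functions. -/
noncomputable def residue : MilnorKMod p (RatFunc F) (n + 1) →+ MilnorKMod p κ n :=
  (tame p κ n).comp (map p (ratExpand φ θ) (n + 1))

theorem residue_symbol (a : Fin (n + 1) → Additive (RatFunc F)ˣ) :
    residue p φ θ n (symbol p (RatFunc F) (n + 1) a) = ∑ i : Fin (n + 1), (-1) ^ (i : ℕ) •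
      ordAt φ θ (a i) • symbol p κ n fun k => coeffAt φ θ (a (i.succAbove k)) :=
  (congrArg (tame p κ n) (map_symbolMultilinear p _ a)).trans (tame_symbolMultilinear ..)

/-- The specialization map at `θ` on Milnor K-theory modulo `p` of the field of rational
functions. -/
noncomputable def specializeAt : MilnorKMod p (RatFunc F) n →+ MilnorKMod p κ n :=
  (specialize p κ n).comp (map p (ratExpand φ θ) n)

theorem specializeAt_symbol (a : Fin n → Additive (RatFunc F)ˣ) :
    specializeAt p φ θ n (symbol p (RatFunc F) n a) = symbol p κ n fun k => coeffAt φ θ (a k) :=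
  (congrArg (specialize p κ n) (map_symbolMultilinear p _ a)).trans
    (specialize_symbolMultilinear ..)

theorem specializeAt_map_C (x : MilnorKMod p F n) :
    specializeAt p φ θ n (map p RatFunc.C n x) = map p φ n x := by
  suffices (specializeAt p φ θ n).comp (map p RatFunc.C n) = map p φ n from
    DFunLike.congr_fun this x
  refine addHom_ext fun a => ?_
  rw [AddMonoidHom.comp_apply, ← symbol_eq_symbolMultilinear, map_symbol, map_symbol,
    specializeAt_symbol]
  simp only [coeffAt_C]

end Residue

end MilnorKMod

theorem AlternatingMap.map_update_sub_update_sub {ι M A : Type*} [DecidableEq ι]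
    [AddCommGroup M] [AddCommGroup A] (G : M [⋀^ι]→ₗ[ℤ] A) (a : ι → M) {i j : ι} (hij : i ≠ j)
    (x y z : M) :
    G (update (update a i (x - z)) j (y - z)) = G (update (update a i x) j y) -
      G (update (update a i z) j y) - G (update (update a i x) j z) := by
  have h : G (update (update a i z) j z) = 0 :=
    G.map_eq_zero_of_eq _ (by simp [update_of_ne hij]) hij
  have h1 := G.map_update_sub (update a j y) i x z
  have h2 := G.map_update_sub (update a j z) i x z
  simp only [update_comm hij.symm] at h1 h2
  rw [G.map_update_sub, h1, h2, h, sub_zero]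

theorem MultilinearMap.mem_of_forall_mem_closure {ι M A : Type*} [Finite ι]
    [AddCommGroup M] [AddCommGroup A] (G : MultilinearMap ℤ (fun _ : ι => M) A) {S : Set M}
    {H : AddSubgroup A} (h : ∀ a, (∀ i, a i ∈ S) → G a ∈ H) {a : ι → M}
    (ha : ∀ i, a i ∈ AddSubgroup.closure S) : G a ∈ H := by
  classical
  have := Fintype.ofFinite ι
  suffices ∀ (s : Finset ι) (a : ι → M), (∀ i ∈ s, a i ∈ AddSubgroup.closure S) →
      (∀ i ∉ s, a i ∈ S) → G a ∈ H from
    this Finset.univ a (fun i _ => ha i) fun i hi => absurd (Finset.mem_univ i) hi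
  intro s
  induction s using Finset.induction_on with
  | empty => exact fun a _ ha => h a fun i => ha i (Finset.notMem_empty i)
  | insert i s his ih =>
    intro a h1 h2
    rw [← update_eq_self i a]
    refine AddSubgroup.closure_induction (p := fun x _ => G (update a i x) ∈ H) (fun x hx => ?_)
      ?_ (fun x y _ _ hx hy => ?_) (fun x _ hx => ?_) (h1 i (Finset.mem_insert_self i s))
    · refine ih _ (fun k hk => ?_) (fun k hk => ?_)
      · rw [update_of_ne (ne_of_mem_of_not_mem hk his)]
        exact h1 k (Finset.mem_insert_of_mem hk)
      · obtain rfl | hki := eq_or_ne k i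
        · rwa [update_self]
        · rw [update_of_ne hki]
          exact h2 k (by simp [hki, hk])
    · rw [G.map_update_zero]
      exact H.zero_mem
    · rw [G.map_update_add]
      exact H.add_mem hx hy
    · rw [← neg_one_smul ℤ x, G.map_update_smul, neg_one_smul]
      exact H.neg_mem hx

section LowDegree

variable (F : Type*) [Field F] (d : ℕ)

/-- The units defined by nonzero polynomials of degree less than `d`. -/
def lowDegreeUnits : Set (Additive (RatFunc F)ˣ) :=
  {x | ∃ (g : F[X]) (hg : g ≠ 0), g.natDegree < d ∧ x = polyUnit g hg}

/-- Monic irreducible polynomials of degree `d`. -/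
abbrev MonicIrreducible : Type _ :=
  {f : F[X] // f.Monic ∧ Irreducible f ∧ f.natDegree = d}

variable {F d}

instance (π : MonicIrreducible F d) : Fact (Irreducible π.1) := ⟨π.2.2.1⟩

/-- The unit defined by a monic irreducible polynomial. -/
noncomputable def MonicIrreducible.unit (π : MonicIrreducible F d) : Additive (RatFunc F)ˣ :=
  polyUnit π.1 π.2.1.ne_zero

theorem polyUnit_mul {f g : F[X]} (hf : f ≠ 0) (hg : g ≠ 0) :
    polyUnit (f * g) (mul_ne_zero hf hg) = polyUnit f hf + polyUnit g hg :=
  additiveUnits_ext (map_mul (algebraMap F[X] (RatFunc F)) f g)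

theorem lowDegreeUnits_succ_subset_closure (hd : 1 ≤ d) :
    lowDegreeUnits F (d + 1) ⊆ AddSubgroup.closure
      (lowDegreeUnits F d ∪ Set.range (MonicIrreducible.unit (F := F) (d := d))) := by
  rintro _ ⟨g, hg, hgd, rfl⟩
  obtain hlt | heq := Nat.lt_or_eq_of_le (Nat.lt_succ_iff.1 hgd)
  · exact AddSubgroup.subset_closure (Or.inl ⟨g, hg, hlt, rfl⟩)
  by_cases hi : Irreducible g
  · have hlc : C g.leadingCoeff ≠ 0 := C_ne_zero.2 (leadingCoeff_ne_zero.2 hg)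
    have hm := monic_mul_leadingCoeff_inv hg
    have h : g = C g.leadingCoeff * (g * C g.leadingCoeff⁻¹) := by
      rw [mul_comm g, ← mul_assoc, ← C_mul, mul_inv_cancel₀ (leadingCoeff_ne_zero.2 hg), C_1,
        one_mul]
    have h' : polyUnit g hg = polyUnit (C g.leadingCoeff) hlc +
        MonicIrreducible.unit ⟨g * C g.leadingCoeff⁻¹, hm, irreducible_mul_leadingCoeff_inv.2 hi,
          (natDegree_mul_leadingCoeff_inv g hg).trans heq⟩ := by
      refine additiveUnits_ext ?_
      refine (congrArg (algebraMap F[X] (RatFunc F)) h).trans ?_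
      exact map_mul _ _ _
    rw [h']
    refine add_mem (AddSubgroup.subset_closure (Or.inl ⟨_, hlc, ?_, rfl⟩))
      (AddSubgroup.subset_closure (Or.inr ⟨_, rfl⟩))
    rw [natDegree_C]
    exact hd
  · have hu : ¬IsUnit g := fun h => by
      have := natDegree_eq_zero_of_isUnit h
      lia
    obtain ⟨a, b, ha, hb, rfl⟩ : ∃ a b, ¬IsUnit a ∧ ¬IsUnit b ∧ g = a * b := by
      by_contra! hcon
      exact hi ⟨hu, fun a b hab => or_iff_not_imp_left.2 fun ha => by
        by_contra hb
        exact hcon a b ha hb hab⟩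
    have ha0 := left_ne_zero_of_mul hg
    have hb0 := right_ne_zero_of_mul hg
    rw [natDegree_mul ha0 hb0] at heq
    have ha1 : a.natDegree ≠ 0 := fun h => ha (isUnit_iff_degree_eq_zero.2
      (by rw [degree_eq_natDegree ha0, h]; rfl))
    have hb1 : b.natDegree ≠ 0 := fun h => hb (isUnit_iff_degree_eq_zero.2
      (by rw [degree_eq_natDegree hb0, h]; rfl))
    rw [polyUnit_mul ha0 hb0]
    exact add_mem (AddSubgroup.subset_closure (Or.inl ⟨a, ha0, by lia, rfl⟩))
      (AddSubgroup.subset_closure (Or.inl ⟨b, hb0, by lia, rfl⟩))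

end LowDegree

namespace MilnorKMod

section Filtration

variable (p : ℕ) [Fact p.Prime] (F : Type*) [Field F] [CharP F p] (d n : ℕ)

/-- The subgroup generated by symbols in polynomials of degree less than `d`. -/
noncomputable def lowDegree : AddSubgroup (MilnorKMod p (RatFunc F) n) :=
  AddSubgroup.closure {z | ∃ a, (∀ i, a i ∈ lowDegreeUnits F d) ∧ z = symbol p (RatFunc F) n a}

variable {F d n}

theorem symbol_mem_lowDegree {a : Fin n → Additive (RatFunc F)ˣ}
    (ha : ∀ i, a i ∈ AddSubgroup.closure (lowDegreeUnits F d)) :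
    symbol p (RatFunc F) n a ∈ lowDegree p F d n :=
  (symbol p (RatFunc F) n).toMultilinearMap.mem_of_forall_mem_closure
    (H := lowDegree p F d n) (fun a ha => AddSubgroup.subset_closure ⟨a, ha, rfl⟩) ha

theorem lowDegree_succ_le (hd : 1 ≤ d) {H : AddSubgroup (MilnorKMod p (RatFunc F) (n + 1))}
    (h1 : lowDegree p F d (n + 1) ≤ H)
    (h2 : ∀ (π : MonicIrreducible F d) (e : Fin n → Additive (RatFunc F)ˣ),
      (∀ i, e i ∈ lowDegreeUnits F d) → symbol p (RatFunc F) (n + 1) (Fin.cons π.unit e) ∈ H) :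
    lowDegree p F (d + 1) (n + 1) ≤ H := by
  classical
  refine (AddSubgroup.closure_le _).2 ?_
  rintro _ ⟨a, ha, rfl⟩
  refine (symbol p (RatFunc F) (n + 1)).toMultilinearMap.mem_of_forall_mem_closure (fun a ha => ?_)
    fun i => lowDegreeUnits_succ_subset_closure hd (ha i)
  change symbol p (RatFunc F) (n + 1) a ∈ H
  clear * - ha h1 h2
  obtain ⟨s, hs⟩ : ∃ s : Finset (Fin (n + 1)), ∀ i ∉ s, a i ∈ lowDegreeUnits F d :=
    ⟨Finset.univ, fun i hi => absurd (Finset.mem_univ i) hi⟩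
  induction s using Finset.strongInduction generalizing a with
  | H s ih =>
  by_cases hall : ∀ i ∈ s, a i ∈ lowDegreeUnits F d
  · exact h1 (symbol_mem_lowDegree p fun i => AddSubgroup.subset_closure <|
      if hi : i ∈ s then hall i hi else hs i hi)
  push Not at hall
  obtain ⟨i, his, hi⟩ := hall
  obtain ⟨π, hπ⟩ := (ha i).resolve_left hi
  by_cases hj : ∀ j ≠ i, a j ∈ lowDegreeUnits F d
  · rw [← Fin.insertNth_self_removeNth i a, AlternatingMap.map_insertNth, ← hπ]
    exact zsmul_mem (h2 π (i.removeNth a) fun k => hj _ (Fin.succAbove_ne i k)) _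
  push Not at hj
  obtain ⟨j, hji, hj⟩ := hj
  have hjs : j ∈ s := by_contra fun h => hj (hs j h)
  obtain ⟨π', hπ'⟩ := (ha j).resolve_left hj
  by_cases hππ' : π = π'
  · rw [(symbol p (RatFunc F) (n + 1)).map_eq_zero_of_eq a (by rw [← hπ, ← hπ', hππ']) hji.symm]
    exact H.zero_mem
  have hg : π.1 - π'.1 ≠ 0 := sub_ne_zero.2 fun h => hππ' (Subtype.ext h)
  have hgd : (π.1 - π'.1).natDegree < d := by
    have hdeg : π.1.degree = π'.1.degree := by
      rw [degree_eq_natDegree π.2.1.ne_zero, degree_eq_natDegree π'.2.1.ne_zero, π.2.2.2, π'.2.2.2]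
    have := natDegree_lt_natDegree hg (degree_sub_lt_left hdeg π.2.1.ne_zero
      (by rw [π.2.1.leadingCoeff, π'.2.1.leadingCoeff]))
    rwa [π.2.2.2] at this
  have hG : polyUnit _ hg ∈ lowDegreeUnits F d := ⟨_, hg, hgd, rfl⟩
  have key := symbol_eq_zero_of_add_eq p a hji.symm (x := polyUnit _ hg) (y := π'.unit)
    (z := π.unit) <| by
      change algebraMap F[X] (RatFunc F) _ + algebraMap F[X] (RatFunc F) _ =
        algebraMap F[X] (RatFunc F) _
      rw [← map_add, sub_add_cancel]
  have e1 : update (update a i π.unit) j π'.unit = a := by rw [hπ, hπ']; simp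
  have e2 : update (update a i (polyUnit _ hg)) j π'.unit = update a i (polyUnit _ hg) := by
    rw [update_comm hji.symm, hπ', update_eq_self]
  rw [AlternatingMap.map_update_sub_update_sub _ _ hji.symm, e1, e2, sub_right_comm,
    sub_eq_zero] at key
  rw [← key]
  have hmem (k l : Fin (n + 1)) (x : Additive (RatFunc F)ˣ)
      (hx : x ∈ lowDegreeUnits F d ∪ Set.range (MonicIrreducible.unit (F := F) (d := d)))
      (b : Fin (n + 1) → Additive (RatFunc F)ˣ)
      (hb : ∀ i, b i ∈ lowDegreeUnits F d ∪ Set.range (MonicIrreducible.unit (F := F) (d := d))) :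
      update b k x l ∈ lowDegreeUnits F d ∪ Set.range (MonicIrreducible.unit (d := d)) := by
    obtain rfl | h := eq_or_ne l k
    · rwa [update_self]
    · rw [update_of_ne h]
      exact hb l
  refine H.sub_mem (ih (s.erase i) (Finset.erase_ssubset his) _
    (fun k => hmem i k _ (Or.inl hG) a ha) fun k hk => ?_) (ih (s.erase i)
      (Finset.erase_ssubset his) _ (fun k => hmem j k _ (Or.inr ⟨π, rfl⟩) _
        fun k => hmem i k _ (Or.inl hG) a ha) fun k hk => ?_)
  · obtain rfl | h := eq_or_ne k i
    · rwa [update_self]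
    · rw [update_of_ne h]
      exact hs k fun h' => hk (Finset.mem_erase.2 ⟨h, h'⟩)
  · have hkj : k ≠ j := by
      rintro rfl
      exact hk (Finset.mem_erase.2 ⟨hji, hjs⟩)
    rw [update_of_ne hkj]
    obtain rfl | h := eq_or_ne k i
    · rwa [update_self]
    · rw [update_of_ne h]
      exact hs k fun h' => hk (Finset.mem_erase.2 ⟨h, h'⟩)

end Filtration

end MilnorKMod

section AdjoinRoot

variable {F : Type u} [Field F] {d : ℕ}

theorem adjoinRoot_mk_eq_eval₂ (f g : F[X]) :
    AdjoinRoot.mk f g = g.eval₂ (AdjoinRoot.of f) (AdjoinRoot.root f) := by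
  rw [← AdjoinRoot.aeval_eq]
  rfl

/-- The unit defined by the reduced polynomial representing an element of `F[X]/(π)`. -/
noncomputable def reducedUnit (π : MonicIrreducible F d) (x : Additive (AdjoinRoot π.1)ˣ) :
    Additive (RatFunc F)ˣ :=
  polyUnit (AdjoinRoot.modByMonicHom π.2.1 x.toMul) fun h => x.toMul.ne_zero <| by
    rw [← AdjoinRoot.mk_leftInverse π.2.1 x.toMul, h, map_zero]

theorem natDegree_modByMonicHom_lt (π : MonicIrreducible F d) (x : AdjoinRoot π.1) :
    (AdjoinRoot.modByMonicHom π.2.1 x).natDegree < d := by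
  obtain ⟨g, rfl⟩ := AdjoinRoot.mk_surjective x
  rw [AdjoinRoot.modByMonicHom_mk]
  have := natDegree_modByMonic_lt g π.2.1 π.2.2.1.ne_one
  rwa [π.2.2.2] at this

theorem reducedUnit_mem (π : MonicIrreducible F d) (x : Additive (AdjoinRoot π.1)ˣ) :
    reducedUnit π x ∈ lowDegreeUnits F d :=
  ⟨_, _, natDegree_modByMonicHom_lt π _, rfl⟩

theorem mk_ne_zero_of_natDegree_lt (π : MonicIrreducible F d) {g : F[X]} (hg : g ≠ 0)
    (hgd : g.natDegree < d) : AdjoinRoot.mk π.1 g ≠ 0 := fun h => by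
  have := natDegree_le_of_dvd (AdjoinRoot.mk_eq_zero.1 h) hg
  rw [π.2.2.2] at this
  lia

theorem ordAt_root_of_mem (π : MonicIrreducible F d) {x : Additive (RatFunc F)ˣ}
    (hx : x ∈ lowDegreeUnits F d) :
    ordAt (AdjoinRoot.of π.1) (AdjoinRoot.root π.1) x = 0 ∧
      reducedUnit π (coeffAt (AdjoinRoot.of π.1) (AdjoinRoot.root π.1) x) = x := by
  obtain ⟨g, hg, hgd, rfl⟩ := hx
  have h0 := mk_ne_zero_of_natDegree_lt π hg hgd
  rw [adjoinRoot_mk_eq_eval₂] at h0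
  obtain ⟨h1, h2⟩ := ordAt_polyUnit_of_eval₂_ne_zero hg h0
  refine ⟨h1, additiveUnits_ext ?_⟩
  rw [reducedUnit, coe_polyUnit, coe_polyUnit, h2, ← adjoinRoot_mk_eq_eval₂,
    AdjoinRoot.modByMonicHom_mk, (modByMonic_eq_self_iff π.2.1).2]
  rw [degree_eq_natDegree hg, degree_eq_natDegree π.2.1.ne_zero, π.2.2.2]
  exact_mod_cast hgd

theorem ordAt_root_unit (p : ℕ) [CharP F p] (hdp : d < p) (π : MonicIrreducible F d) :
    ordAt (AdjoinRoot.of π.1) (AdjoinRoot.root π.1) π.unit = 1 := by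
  have hs : π.1.Separable := (separable_iff_derivative_ne_zero π.2.2.1).2 fun h => by
    have hd : 0 < d := π.2.2.2 ▸ π.2.2.1.natDegree_pos
    have h1 := congrArg (fun g => g.coeff (d - 1)) h
    have h2 : π.1.coeff d = 1 := by
      have := π.2.1.coeff_natDegree
      rwa [π.2.2.2] at this
    simp only [coeff_derivative, Nat.sub_add_cancel hd, h2, coeff_zero, one_mul] at h1
    rw [← Nat.cast_succ, Nat.succ_eq_add_one, Nat.sub_add_cancel hd,
      CharP.cast_eq_zero_iff F p] at h1
    exact absurd (Nat.le_of_dvd hd h1) (by lia)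
  exact ordAt_polyUnit_of_simple_root _ (AdjoinRoot.eval₂_root _)
    (hs.eval₂_derivative_ne_zero _ (AdjoinRoot.eval₂_root _))

theorem ordAt_root_unit_of_ne {π π' : MonicIrreducible F d} (h : π ≠ π') :
    ordAt (AdjoinRoot.of π.1) (AdjoinRoot.root π.1) π'.unit = 0 := by
  refine (ordAt_polyUnit_of_eval₂_ne_zero _ fun h0 => h ?_).1
  rw [← adjoinRoot_mk_eq_eval₂, AdjoinRoot.mk_eq_zero] at h0
  exact Subtype.ext (eq_of_monic_of_dvd_of_natDegree_le π.2.1 π'.2.1 h0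
    (by rw [π.2.2.2, π'.2.2.2])).symm

end AdjoinRoot

namespace MilnorKMod

section Filtration

variable (p : ℕ) [Fact p.Prime] {F : Type u} [Field F] [CharP F p] {d : ℕ}

theorem symbol_cons_update_reducedUnit_mem (π : MonicIrreducible F d) {n : ℕ}
    (e : Fin n → Additive (RatFunc F)ˣ) (he : ∀ i, e i ∈ lowDegreeUnits F d) (i : Fin n)
    (x y : Additive (AdjoinRoot π.1)ˣ) :
    symbol p (RatFunc F) (n + 1) (update (Fin.cons π.unit e) i.succ
      (reducedUnit π (x + y) - (reducedUnit π x + reducedUnit π y))) ∈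
        lowDegree p F d (n + 1) := by
  have hX := natDegree_modByMonicHom_lt π x.toMul
  have hY := natDegree_modByMonicHom_lt π y.toMul
  have hZ := natDegree_modByMonicHom_lt π ((x + y).toMul : (AdjoinRoot π.1)ˣ)
  obtain ⟨K, hK⟩ : π.1 ∣ AdjoinRoot.modByMonicHom π.2.1 x.toMul *
      AdjoinRoot.modByMonicHom π.2.1 y.toMul -
      AdjoinRoot.modByMonicHom π.2.1 ((x + y).toMul : (AdjoinRoot π.1)ˣ) := by
    rw [← AdjoinRoot.mk_eq_mk, map_mul, AdjoinRoot.mk_leftInverse π.2.1,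
      AdjoinRoot.mk_leftInverse π.2.1, AdjoinRoot.mk_leftInverse π.2.1]
    rfl
  by_cases hK0 : K = 0
  · have : reducedUnit π (x + y) - (reducedUnit π x + reducedUnit π y) = 0 := by
      rw [sub_eq_zero]
      refine additiveUnits_ext ?_
      rw [hK0, mul_zero, sub_eq_zero] at hK
      simpa [reducedUnit, coe_polyUnit] using (congrArg (algebraMap F[X] (RatFunc F)) hK).symm
    rw [this, AlternatingMap.map_update_zero]
    exact zero_mem _
  have hKd : K.natDegree < d := by
    have h1 := natDegree_sub_le (AdjoinRoot.modByMonicHom π.2.1 x.toMul *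
      AdjoinRoot.modByMonicHom π.2.1 y.toMul)
      (AdjoinRoot.modByMonicHom π.2.1 ((x + y).toMul : (AdjoinRoot π.1)ˣ))
    have h2 := natDegree_mul_le (p := AdjoinRoot.modByMonicHom π.2.1 x.toMul)
      (q := AdjoinRoot.modByMonicHom π.2.1 y.toMul)
    rw [hK, natDegree_mul π.2.1.ne_zero hK0] at h1
    have h3 := π.2.2.2
    lia
  have hKm : polyUnit K hK0 ∈ lowDegreeUnits F d := ⟨K, hK0, hKd, rfl⟩
  have key := symbol_eq_zero_of_add_eq p (Fin.cons π.unit e) (Fin.succ_ne_zero i)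
    (x := reducedUnit π (x + y)) (y := π.unit + polyUnit K hK0)
    (z := reducedUnit π x + reducedUnit π y) <| by
      have := congrArg (algebraMap F[X] (RatFunc F)) hK
      simp only [map_sub, map_mul] at this
      simp only [MonicIrreducible.unit, reducedUnit, toMul_add, Units.val_mul, coe_polyUnit]
      simp only [toMul_add, Units.val_mul] at this ⊢
      linear_combination -this
  rw [add_sub_assoc, AlternatingMap.map_update_add] at key
  have e1 : update (update (Fin.cons π.unit e : Fin (n + 1) → Additive (RatFunc F)ˣ) i.succ
      (reducedUnit π (x + y) - (reducedUnit π x + reducedUnit π y))) 0 π.unit =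
      update (Fin.cons π.unit e : Fin (n + 1) → Additive (RatFunc F)ˣ) i.succ
        (reducedUnit π (x + y) - (reducedUnit π x + reducedUnit π y)) := by
    rw [update_eq_self_iff, update_of_ne (Fin.succ_ne_zero i).symm, Fin.cons_zero]
  rw [e1, add_eq_zero_iff_eq_neg] at key
  rw [key]
  have hXY : reducedUnit π x + reducedUnit π y ∈ AddSubgroup.closure (lowDegreeUnits F d) :=
    add_mem (AddSubgroup.subset_closure (reducedUnit_mem π x))
      (AddSubgroup.subset_closure (reducedUnit_mem π y))
  refine neg_mem (symbol_mem_lowDegree p fun k => ?_)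
  refine Fin.cases ?_ (fun k => ?_) k
  · rw [update_self]
    exact sub_mem (AddSubgroup.subset_closure hKm) hXY
  · rw [update_of_ne (Fin.succ_ne_zero k)]
    obtain rfl | hk := eq_or_ne k i
    · rw [update_self]
      exact sub_mem (AddSubgroup.subset_closure (reducedUnit_mem π _)) hXY
    · rw [update_of_ne fun h => hk (Fin.succ_injective _ h), Fin.cons_succ]
      exact AddSubgroup.subset_closure (he k)

/-- The multilinear map underlying `liftResidue`. -/
noncomputable def liftResidueMultilinear (π : MonicIrreducible F d) (n : ℕ) :
    MultilinearMap ℤ (fun _ : Fin n => Additive (AdjoinRoot π.1)ˣ)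
      (MilnorKMod p (RatFunc F) (n + 1) ⧸ lowDegree p F d (n + 1)) :=
  have hadd (m : Fin n → Additive (AdjoinRoot π.1)ˣ) (i : Fin n)
      (x y : Additive (AdjoinRoot π.1)ˣ) :
      QuotientAddGroup.mk' (lowDegree p F d (n + 1)) (symbol p (RatFunc F) (n + 1)
        (Fin.cons π.unit (reducedUnit π ∘ update m i (x + y)))) =
      QuotientAddGroup.mk' (lowDegree p F d (n + 1)) (symbol p (RatFunc F) (n + 1)
        (Fin.cons π.unit (reducedUnit π ∘ update m i x))) +
      QuotientAddGroup.mk' (lowDegree p F d (n + 1)) (symbol p (RatFunc F) (n + 1)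
        (Fin.cons π.unit (reducedUnit π ∘ update m i y))) := by
    have h := symbol_cons_update_reducedUnit_mem p π (reducedUnit π ∘ m)
      (fun _ => reducedUnit_mem π _) i x y
    rw [← map_add, ← sub_eq_zero, ← map_sub, QuotientAddGroup.mk'_apply,
      QuotientAddGroup.eq_zero_iff]
    simpa only [comp_update, Fin.cons_update, AlternatingMap.map_update_sub,
      AlternatingMap.map_update_add] using h
  MultilinearMap.mk' (fun x => QuotientAddGroup.mk' (lowDegree p F d (n + 1))
    (symbol p (RatFunc F) (n + 1) (Fin.cons π.unit (reducedUnit π ∘ x)))) hadd fun m i c x =>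
      (AddMonoidHom.mk' (fun x => QuotientAddGroup.mk' (lowDegree p F d (n + 1))
        (symbol p (RatFunc F) (n + 1) (Fin.cons π.unit (reducedUnit π ∘ update m i x))))
        (hadd m i)).map_zsmul c x

/-- The homomorphism `α ↦ {π, α}` splitting the residue map at `π`, modulo symbols of lower
degree. -/
noncomputable def liftResidue (π : MonicIrreducible F d) (n : ℕ) :
    MilnorKMod p (AdjoinRoot π.1) n →+
      MilnorKMod p (RatFunc F) (n + 1) ⧸ lowDegree p F d (n + 1) :=
  lift p (liftResidueMultilinear p π n)
    (fun x => by
      obtain ⟨x, rfl⟩ := QuotientAddGroup.mk'_surjective _ x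
      rw [← map_nsmul, nsmul_eq_zero, map_zero])
    fun a i j hij h => by
      change QuotientAddGroup.mk' (lowDegree p F d (n + 1)) (symbol p (RatFunc F) (n + 1) _) = 0
      rw [symbol_eq_zero_of_add_eq_one p _ (i := i.succ) (j := j.succ)
        (fun h => hij (Fin.succ_injective _ h)), map_zero]
      have h1 : AdjoinRoot.modByMonicHom π.2.1 1 = 1 := by
        rw [← map_one (AdjoinRoot.mk π.1), AdjoinRoot.modByMonicHom_mk,
          (modByMonic_eq_self_iff π.2.1).2]
        rw [degree_one, ← natDegree_pos_iff_degree_pos]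
        exact π.2.2.1.natDegree_pos
      simp only [Fin.cons_succ, comp_apply, reducedUnit, coe_polyUnit]
      rw [← map_add, ← map_add, h, h1, map_one]

theorem liftResidue_symbolMultilinear (π : MonicIrreducible F d) {n : ℕ}
    (a : Fin n → Additive (AdjoinRoot π.1)ˣ) :
    liftResidue p π n (symbolMultilinear p a) = QuotientAddGroup.mk' (lowDegree p F d (n + 1))
      (symbol p (RatFunc F) (n + 1) (Fin.cons π.unit (reducedUnit π ∘ a))) :=
  lift_symbolMultilinear ..

instance charP_adjoinRoot (π : MonicIrreducible F d) : CharP (AdjoinRoot π.1) p :=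
  charP_of_injective_ringHom (AdjoinRoot.of π.1).injective p

theorem residue_eq_zero_of_mem_lowDegree (π : MonicIrreducible F d) {n : ℕ}
    {z : MilnorKMod p (RatFunc F) (n + 1)} (hz : z ∈ lowDegree p F d (n + 1)) :
    residue p (AdjoinRoot.of π.1) (AdjoinRoot.root π.1) n z = 0 := by
  suffices lowDegree p F d (n + 1) ≤
      (residue p (AdjoinRoot.of π.1) (AdjoinRoot.root π.1) n).ker from this hz
  refine (AddSubgroup.closure_le _).2 ?_
  rintro _ ⟨a, ha, rfl⟩
  change residue p (AdjoinRoot.of π.1) (AdjoinRoot.root π.1) n _ = 0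
  rw [residue_symbol]
  refine Finset.sum_eq_zero fun i _ => ?_
  rw [(ordAt_root_of_mem π (ha i)).1, zero_smul, smul_zero]

theorem residue_symbol_cons (π π' : MonicIrreducible F d) {n : ℕ}
    {e : Fin n → Additive (RatFunc F)ˣ} (he : ∀ i, e i ∈ lowDegreeUnits F d) :
    residue p (AdjoinRoot.of π'.1) (AdjoinRoot.root π'.1) n
      (symbol p (RatFunc F) (n + 1) (Fin.cons π.unit e)) =
      ordAt (AdjoinRoot.of π'.1) (AdjoinRoot.root π'.1) π.unit •
        symbol p (AdjoinRoot π'.1) n fun k =>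
          coeffAt (AdjoinRoot.of π'.1) (AdjoinRoot.root π'.1) (e k) := by
  rw [residue_symbol, Fin.sum_univ_succ, Finset.sum_eq_zero fun i _ => ?_]
  · simp
  · rw [Fin.cons_succ, (ordAt_root_of_mem π' (he i)).1, zero_smul, smul_zero]

/-- Modulo symbols of degree less than `d`, a sum of symbols of degree at most `d` is determined by
its residues. -/
theorem mk_eq_sum_liftResidue (hd : 1 ≤ d) (hdp : d < p) {n : ℕ}
    {z : MilnorKMod p (RatFunc F) (n + 1)} (hz : z ∈ lowDegree p F (d + 1) (n + 1)) :
    ∃ s₀ : Finset (MonicIrreducible F d), ∀ s, s₀ ⊆ s →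
      QuotientAddGroup.mk' (lowDegree p F d (n + 1)) z = ∑ π ∈ s, liftResidue p π n
        (residue p (AdjoinRoot.of π.1) (AdjoinRoot.root π.1) n z) := by
  classical
  let H : AddSubgroup (MilnorKMod p (RatFunc F) (n + 1)) :=
    { carrier := {z | ∃ s₀ : Finset (MonicIrreducible F d), ∀ s, s₀ ⊆ s →
        QuotientAddGroup.mk' (lowDegree p F d (n + 1)) z = ∑ π ∈ s, liftResidue p π n
          (residue p (AdjoinRoot.of π.1) (AdjoinRoot.root π.1) n z)}
      zero_mem' := ⟨∅, fun s _ => by simp only [map_zero, Finset.sum_const_zero]⟩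
      add_mem' := by
        rintro x y ⟨s, hs⟩ ⟨t, ht⟩
        refine ⟨s ∪ t, fun r hr => ?_⟩
        simp only [map_add, Finset.sum_add_distrib]
        rw [← hs r (Finset.union_subset_left hr), ← ht r (Finset.union_subset_right hr)]
      neg_mem' := by
        rintro x ⟨s, hs⟩
        refine ⟨s, fun r hr => ?_⟩
        simp only [map_neg, Finset.sum_neg_distrib]
        rw [← hs r hr] }
  refine lowDegree_succ_le p hd (H := H) (fun z hz => ⟨∅, fun s _ => ?_⟩)
    (fun π e he => ⟨{π}, fun s hs => ?_⟩) hz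
  · rw [Finset.sum_eq_zero fun π _ => by rw [residue_eq_zero_of_mem_lowDegree p π hz, map_zero]]
    exact (QuotientAddGroup.eq_zero_iff z).2 hz
  · rw [Finset.sum_eq_single_of_mem π (hs (Finset.mem_singleton_self π)) fun π' _ hne => by
      rw [residue_symbol_cons p π π' he, ordAt_root_unit_of_ne hne, zero_smul, map_zero],
      residue_symbol_cons p π π he, ordAt_root_unit p hdp, one_smul,
      symbol_eq_symbolMultilinear p (F := AdjoinRoot π.1), liftResidue_symbolMultilinear]
    congr
    exact funext fun k => (ordAt_root_of_mem π (he k)).2.symm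

theorem lowDegree_one_le {n : ℕ} :
    lowDegree p F 1 n ≤ (map p (RatFunc.C (K := F)) n).range := by
  refine (AddSubgroup.closure_le _).2 ?_
  rintro _ ⟨a, ha, rfl⟩
  have h (i : Fin n) : ∃ x, a i = unitsAddMap (RatFunc.C (K := F)) x := by
    obtain ⟨g, hg, hgd, hx⟩ := ha i
    have hg' := eq_C_of_natDegree_eq_zero (Nat.lt_one_iff.1 hgd)
    have h0 : g.coeff 0 ≠ 0 := fun h => hg (by rw [hg', h, C_0])
    refine ⟨Additive.ofMul (Units.mk0 _ h0), ?_⟩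
    rw [hx, map_C_eq_polyUnit]
    exact additiveUnits_ext (congrArg (algebraMap F[X] (RatFunc F)) hg')
  choose x hx using h
  exact ⟨symbol p F n x, by rw [map_symbol, funext hx]⟩

/-- A sum of symbols of polynomials of degree less than `p` without residues is constant. -/
theorem mem_range_of_residue_eq_zero (hd : 1 ≤ d) (hdp : d ≤ p) {n : ℕ}
    {z : MilnorKMod p (RatFunc F) (n + 1)} (hz : z ∈ lowDegree p F d (n + 1))
    (h : ∀ (κ : Type u) [Field κ] [CharP κ p] (φ : F →+* κ) (θ : κ), residue p φ θ n z = 0) :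
    z ∈ (map p (RatFunc.C (K := F)) (n + 1)).range := by
  induction d, hd using Nat.le_induction with
  | base => exact lowDegree_one_le p hz
  | succ d hd ih =>
    obtain ⟨s, hs⟩ := mk_eq_sum_liftResidue p hd hdp hz
    refine ih (by lia) ((QuotientAddGroup.eq_zero_iff z).1 ((hs s subset_rfl).trans ?_))
    refine Finset.sum_eq_zero fun π _ => ?_
    rw [h, map_zero]

end Filtration

end MilnorKMod

section Subfield

variable {F : Type*} [Field F]

theorem exists_polynomial_of_mem_adjoin {p : ℕ} [Fact p.Prime] {E : Subfield F} {b x : F}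
    (hb : b ^ p ∈ E) (hx : x ∈ IntermediateField.adjoin E {b}) :
    ∃ g : F[X], (∀ n, g.coeff n ∈ E) ∧ g.natDegree < p ∧ g.eval b = x := by
  have hp := (Fact.out : p.Prime)
  obtain ⟨f, hf, hfd, hfb⟩ : ∃ f : E[X], f.Monic ∧ f.natDegree = p ∧ aeval b f = 0 :=
    ⟨X ^ p - C ⟨b ^ p, hb⟩, monic_X_pow_sub_C _ hp.ne_zero, natDegree_X_pow_sub_C, by
      rw [map_sub, map_pow, aeval_X, aeval_C]
      exact sub_self (b ^ p)⟩
  have hx' : x ∈ Algebra.adjoin E {b} := by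
    rw [← IntermediateField.adjoin_simple_toSubalgebra_of_isAlgebraic
      (IsIntegral.isAlgebraic ⟨f, hf, hfb⟩)]
    exact hx
  rw [Algebra.adjoin_singleton_eq_range_aeval] at hx'
  obtain ⟨g, rfl⟩ := hx'
  refine ⟨(g %ₘ f).map (algebraMap E F), fun n => ?_, ?_, ?_⟩
  · rw [coeff_map]
    exact ((g %ₘ f).coeff n).2
  · rw [natDegree_map, ← hfd]
    refine natDegree_modByMonic_lt g hf fun h => ?_
    rw [h, natDegree_one] at hfd
    exact hp.ne_zero hfd.symm
  · rw [eval_map_algebraMap]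
    exact aeval_modByMonic_eq_self_of_root hfb

theorem exists_map_subtype_eq {E : Subfield F} {g : F[X]} (hg : ∀ n, g.coeff n ∈ E) :
    ∃ f : E[X], f.map E.subtype = g := by
  refine (mem_lifts g).1 ((lifts_iff_coeff_lifts g).2 fun n => ⟨⟨_, hg n⟩, rfl⟩)

theorem coeff_taylor_mem {E : Subfield F} {g : F[X]} (hg : ∀ n, g.coeff n ∈ E) {θ : F}
    (hθ : θ ∈ E) (n : ℕ) : (taylor θ g).coeff n ∈ E := by
  rw [taylor_coeff, eval_eq_sum_range]
  refine sum_mem fun i _ => mul_mem ?_ (pow_mem hθ i)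
  rw [hasseDeriv_coeff]
  exact mul_mem (natCast_mem E _) (hg _)

end Subfield

section PClosure

variable (p : ℕ) [Fact p.Prime] {F κ : Type*} [Field F] [Field κ] [CharP F p] [CharP κ p]

/-- The subfield generated by the `p`-th powers and a given set. -/
def pClosure (S : Set F) : Subfield F := Subfield.closure (Set.range (frobenius F p) ∪ S)

variable {p}

theorem pow_mem_pClosure (S : Set F) (x : F) : x ^ p ∈ pClosure p S :=
  Subfield.subset_closure (Or.inl ⟨x, rfl⟩)

theorem subset_pClosure (S : Set F) : S ⊆ pClosure p S :=
  fun _ hx => Subfield.subset_closure (Or.inr hx)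

theorem pClosure_le {S : Set F} {E : Subfield F} :
    pClosure p S ≤ E ↔ (∀ x, x ^ p ∈ E) ∧ S ⊆ E := by
  rw [pClosure, Subfield.closure_le, Set.union_subset_iff, Set.range_subset_iff]
  rfl

theorem pClosure_mono {S T : Set F} (h : S ⊆ T) : pClosure p S ≤ pClosure p T :=
  pClosure_le.2 ⟨pow_mem_pClosure T, h.trans (subset_pClosure T)⟩

theorem pClosure_empty : pClosure p (∅ : Set F) = (frobenius F p).fieldRange := by
  refine le_antisymm (pClosure_le.2 ⟨fun x => ⟨x, rfl⟩, Set.empty_subset _⟩) ?_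
  rintro _ ⟨x, rfl⟩
  exact pow_mem_pClosure _ x

theorem map_mem_pClosure (φ : F →+* κ) {S : Set F} {x : F} (hx : x ∈ pClosure p S) :
    φ x ∈ pClosure p (φ '' S) := by
  have h : pClosure p S ≤ (pClosure p (φ '' S)).comap φ := by
    refine pClosure_le.2 ⟨fun x => ?_, fun x hx => subset_pClosure _ ⟨x, hx, rfl⟩⟩
    rw [Subfield.mem_comap, map_pow]
    exact pow_mem_pClosure _ _
  exact h hx

theorem exists_polynomial_of_mem_pClosure_insert {S : Set F} {b x : F}
    (hx : x ∈ pClosure p (insert b S)) :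
    ∃ g : F[X], (∀ n, g.coeff n ∈ pClosure p S) ∧ g.natDegree < p ∧ g.eval b = x := by
  have hle : pClosure p (insert b S) ≤
      (IntermediateField.adjoin (pClosure p S) {b}).toSubfield := by
    refine pClosure_le.2 ⟨fun y => ?_, Set.insert_subset ?_ fun y hy => ?_⟩
    · exact (IntermediateField.adjoin (pClosure p S) {b}).algebraMap_mem
        ⟨_, pow_mem_pClosure S y⟩
    · exact IntermediateField.mem_adjoin_simple_self _ b
    · exact (IntermediateField.adjoin (pClosure p S) {b}).algebraMap_mem
        ⟨y, subset_pClosure S hy⟩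
  exact exists_polynomial_of_mem_adjoin (pow_mem_pClosure S b) (hle hx)

theorem mem_of_eval_eq_zero {E : Subfield F} {g : F[X]} (hg : ∀ n, g.coeff n ∈ E) (hg0 : g ≠ 0)
    (hgd : g.natDegree < p) {θ : F} (hθ : θ ^ p ∈ E) (h : g.eval θ = 0) : θ ∈ E := by
  have hp := (Fact.out : p.Prime)
  obtain ⟨f, rfl⟩ := exists_map_subtype_eq hg
  by_contra hθE
  have hirr : Irreducible (X ^ p - C (⟨θ ^ p, hθ⟩ : E)) := by
    refine X_pow_sub_C_irreducible_of_prime hp fun b hb => hθE ?_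
    have : (b : F) ^ p = θ ^ p := congrArg Subtype.val hb
    exact frobenius_inj F p this ▸ b.2
  have hmin := minpoly.eq_of_irreducible_of_monic (A := E) (x := θ) hirr
    (by rw [map_sub, map_pow, aeval_X, aeval_C]; exact sub_self (θ ^ p))
    (monic_X_pow_sub_C _ hp.ne_zero)
  have hdvd := minpoly.dvd E θ (p := f) (by rw [aeval_def, ← eval_map]; exact h)
  rw [← hmin] at hdvd
  have := natDegree_le_of_dvd hdvd fun h0 => hg0 (by rw [h0, Polynomial.map_zero])
  rw [natDegree_X_pow_sub_C] at this
  rw [natDegree_map] at hgd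
  lia

end PClosure

namespace MilnorKMod

section PDependence

variable (p : ℕ) [Fact p.Prime]

theorem symbol_eq_zero_of_mem_fieldRange {F : Type*} [Field F] [CharP F p] {q : ℕ}
    (a : Fin q → Additive Fˣ) (j : Fin q)
    (h : ((a j).toMul : F) ∈ (frobenius F p).fieldRange) : symbol p F q a = 0 := by
  obtain ⟨y, hy⟩ := h
  have hy0 : y ≠ 0 := by
    rintro rfl
    exact (a j).toMul.ne_zero (hy.symm.trans (map_zero _))
  have h : a j = (p : ℤ) • Additive.ofMul (Units.mk0 y hy0) :=
    additiveUnits_ext (by simpa [frobenius_def] using hy.symm)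
  rw [← update_eq_self j a, h, AlternatingMap.map_update_smul, natCast_zsmul, nsmul_eq_zero]

/-- The values of a family of units over a finite set of indices. -/
def unitsImage {F : Type*} [Field F] {q : ℕ} (a : Fin q → Additive Fˣ) (I : Finset (Fin q)) :
    Set F :=
  (fun i => ((a i).toMul : F)) '' I

variable {p} in
/-- Reduction of a `p`-dependence relation along an expansion at `θ`. -/
theorem symbol_coeffAt_eq_zero {F κ : Type*} [Field F] [Field κ] [CharP F p] [CharP κ p]
    (φ : F →+* κ) (θ : κ) {n : ℕ} (a : Fin (n + 1) → Additive Fˣ)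
    (w : Fin (n + 1) → Additive (RatFunc F)ˣ) (I : Finset (Fin (n + 1)))
    (hw : ∀ i ∈ I, w i = unitsAddMap RatFunc.C (a i)) {j k : Fin (n + 1)} (hj : j ∉ I)
    (hk : k ∉ I) (hjk : j ≠ k)
    (h : ((coeffAt φ θ (w j)).toMul : κ) ∈ pClosure p (φ '' unitsImage a I))
    (ih : ∀ (b : Fin n → Additive κˣ) (J : Finset (Fin n)) (l : Fin n), J.card ≤ I.card → l ∉ J →
      ((b l).toMul : κ) ∈ pClosure p (unitsImage b J) → symbol p κ n b = 0) :
    symbol p κ n (fun l => coeffAt φ θ (w (k.succAbove l))) = 0 := by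
  obtain ⟨l, rfl⟩ := Fin.exists_succAbove_eq hjk
  refine ih _ (Finset.univ.filter fun l => k.succAbove l ∈ I) l ?_ (by simpa using hj)
    (pClosure_mono ?_ h)
  · refine Finset.card_le_card_of_injOn k.succAbove (fun l hl => ?_)
      (Fin.succAbove_right_injective).injOn
    exact (Finset.mem_filter.1 hl).2
  · rintro _ ⟨_, ⟨i, hi, rfl⟩, rfl⟩
    obtain ⟨l, rfl⟩ := Fin.exists_succAbove_eq (x := i) (y := k) fun h => hk (h ▸ hi)
    refine ⟨l, by simpa using hi, ?_⟩
    simp only [hw _ hi, coeffAt_C, coe_unitsAddMap]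

/-- A symbol vanishes modulo `p` if one entry is `p`-dependent on the others. -/
theorem symbol_eq_zero_of_mem_pClosure (m : ℕ) :
    ∀ (q : ℕ) (F : Type u) [Field F] [CharP F p] (a : Fin q → Additive Fˣ) (I : Finset (Fin q))
      (j : Fin q), I.card ≤ m → j ∉ I → ((a j).toMul : F) ∈ pClosure p (unitsImage a I) →
      symbol p F q a = 0 := by
  have hp := (Fact.out : p.Prime)
  induction m with
  | zero =>
    intro q F _ _ a I j hI _ h
    rw [Finset.card_eq_zero.1 (Nat.le_zero.1 hI), unitsImage, Finset.coe_empty, Set.image_empty,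
      pClosure_empty] at h
    exact symbol_eq_zero_of_mem_fieldRange p a j h
  | succ m ih =>
    intro q F _ _ a I j hI hj h
    obtain rfl | ⟨i, hi⟩ := I.eq_empty_or_nonempty
    · exact ih q F a ∅ j (by simp) hj h
    obtain _ | n := q
    · exact j.elim0
    have hij : i ≠ j := fun h => hj (h ▸ hi)
    obtain ⟨I₀, hI₀⟩ : ∃ I₀, I₀ = I.erase i := ⟨_, rfl⟩
    have hiI : i ∉ I₀ := hI₀ ▸ Finset.notMem_erase i I
    have hjI : j ∉ I₀ := fun h => hj (Finset.mem_of_mem_erase (hI₀ ▸ h))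
    have hcard : I₀.card ≤ m := by
      rw [hI₀, Finset.card_erase_of_mem hi]
      lia
    rw [← Finset.insert_erase hi, ← hI₀, unitsImage, Finset.coe_insert, Set.image_insert_eq] at h
    obtain ⟨g, hgE, hgd, hgb⟩ := exists_polynomial_of_mem_pClosure_insert h
    have hg0 : g ≠ 0 := by
      rintro rfl
      exact (a j).toMul.ne_zero (hgb.symm.trans eval_zero)
    let w : Fin (n + 1) → Additive (RatFunc F)ˣ :=
      update (update (fun l => unitsAddMap RatFunc.C (a l)) i (polyUnit X X_ne_zero)) j
        (polyUnit g hg0)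
    have hwi : w i = polyUnit X X_ne_zero := by simp [w, hij]
    have hwj : w j = polyUnit g hg0 := by simp [w]
    have hwl {l} (h1 : l ≠ i) (h2 : l ≠ j) : w l = unitsAddMap RatFunc.C (a l) := by
      simp [w, h1, h2]
    have hwI (l) (hl : l ∈ I₀) : w l = unitsAddMap RatFunc.C (a l) :=
      hwl (fun h => hiI (h ▸ hl)) (fun h => hjI (h ▸ hl))
    have hres (κ : Type u) [Field κ] [CharP κ p] (φ : F →+* κ) (θ : κ) :
        residue p φ θ n (symbol p (RatFunc F) (n + 1) w) = 0 := by
      have hgE' (k) : (g.map φ).coeff k ∈ pClosure p (φ '' unitsImage a I₀) := by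
        rw [coeff_map]
        exact map_mem_pClosure φ (hgE k)
      rw [residue_symbol]
      refine Finset.sum_eq_zero fun k _ => ?_
      by_cases hki : k = i
      · subst hki
        by_cases hθ : θ ∈ pClosure p (φ '' unitsImage a I₀)
        · rw [symbol_coeffAt_eq_zero φ θ a w I₀ hwI hjI hiI hij.symm ?_
            fun b J l hJ => ih n κ b J l (hJ.trans hcard), smul_zero, smul_zero]
          rw [hwj]
          obtain ⟨r, hr⟩ := exists_coeffAt_polyUnit (φ := φ) (θ := θ) g hg0
          rw [hr]
          exact coeff_taylor_mem hgE' hθ r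
        · rw [hwi, (ordAt_polyUnit_of_eval₂_ne_zero X_ne_zero ?_).1, zero_smul, smul_zero]
          rw [eval₂_X]
          rintro rfl
          exact hθ (zero_mem _)
      by_cases hkj : k = j
      · subst hkj
        by_cases hθ : θ ∈ pClosure p (φ '' unitsImage a I₀)
        · rw [symbol_coeffAt_eq_zero φ θ a w I₀ hwI hiI hjI hij ?_
            fun b J l hJ => ih n κ b J l (hJ.trans hcard), smul_zero, smul_zero]
          rw [hwi]
          obtain ⟨r, hr⟩ := exists_coeffAt_polyUnit (φ := φ) (θ := θ) X X_ne_zero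
          rw [hr]
          refine coeff_taylor_mem (fun k => ?_) hθ r
          rw [Polynomial.map_X, coeff_X]
          split_ifs
          · exact one_mem _
          · exact zero_mem _
        · rw [hwj, (ordAt_polyUnit_of_eval₂_ne_zero hg0 fun h0 => hθ ?_).1, zero_smul, smul_zero]
          refine mem_of_eval_eq_zero hgE' ((Polynomial.map_ne_zero_iff φ.injective).2 hg0)
            (by rwa [natDegree_map]) (pow_mem_pClosure _ θ) (by rwa [eval_map])
      · rw [hwl hki hkj, ordAt_C, zero_smul, smul_zero]
    have hlow (l) : w l ∈ lowDegreeUnits F p := by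
      by_cases hli : l = i
      · exact hli ▸ ⟨X, X_ne_zero, natDegree_X_le.trans_lt hp.one_lt, hwi⟩
      by_cases hlj : l = j
      · exact hlj ▸ ⟨g, hg0, hgd, hwj⟩
      · exact ⟨C ((a l).toMul : F), C_ne_zero.2 (a l).toMul.ne_zero, by simpa using hp.pos,
          (hwl hli hlj).trans (map_C_eq_polyUnit _)⟩
    obtain ⟨y, hy⟩ := mem_range_of_residue_eq_zero p hp.one_le le_rfl
      (symbol_mem_lowDegree p fun l => AddSubgroup.subset_closure (hlow l)) hres
    have hspec (θ : F) : y = symbol p F (n + 1) fun k => coeffAt (RingHom.id F) θ (w k) := by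
      rw [← specializeAt_symbol, ← hy, specializeAt_map_C, map_id]
    have hy0 : y = 0 := by
      rw [hspec 0]
      refine symbol_eq_zero_of_mem_fieldRange p _ i ?_
      obtain ⟨r, hr⟩ := exists_coeffAt_polyUnit (φ := RingHom.id F) (θ := 0) X X_ne_zero
      have hne := (coeffAt (RingHom.id F) 0 (polyUnit X X_ne_zero)).toMul.ne_zero
      rw [hwi, hr]
      rw [hr] at hne
      rw [Polynomial.map_id, taylor_zero, coeff_X] at hne ⊢
      split_ifs at hne ⊢
      · exact one_mem _
      · exact zero_mem _
    rw [← hy0, hspec ((a i).toMul : F)]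
    congr
    funext l
    refine additiveUnits_ext ?_
    by_cases hli : l = i
    · subst hli
      rw [hwi, (ordAt_polyUnit_of_eval₂_ne_zero X_ne_zero ?_).2, eval₂_X]
      rw [eval₂_X]
      exact (a l).toMul.ne_zero
    by_cases hlj : l = j
    · subst hlj
      rw [hwj, (ordAt_polyUnit_of_eval₂_ne_zero hg0 ?_).2]
      · exact hgb.symm
      · exact hgb.trans_ne (a l).toMul.ne_zero
    · rw [hwl hli hlj, coeffAt_C]
      rfl

end PDependence

end MilnorKMod

section PDegree

theorem Subfield.pow_succ_dvd_relfinrank {E : Type*} [Field E] {p : ℕ} (hp : p.Prime) {δ k : ℕ}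
    {A B C : Subfield E} (hA : Module.finrank A E = p ^ δ) (hAB : A ≤ B) (hBC : B ≤ C)
    (hCB : ¬ C ≤ B) (h : p ^ k ∣ A.relfinrank B) : p ^ (k + 1) ∣ A.relfinrank C := by
  rw [← relfinrank_mul_relfinrank hAB hBC, pow_succ]
  refine mul_dvd_mul h ?_
  have hdvd : B.relfinrank C ∣ p ^ δ :=
    hA ▸ (relfinrank_dvd_finrank_top_of_le hBC).trans
      (Dvd.intro_left _ (relfinrank_mul_finrank_top hAB))
  obtain ⟨r, -, hr⟩ := (Nat.dvd_prime_pow hp).1 hdvd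
  rw [hr]
  refine dvd_pow_self p ?_
  rintro rfl
  exact hCB (relfinrank_eq_one_iff.1 hr)

variable (p : ℕ) [Fact p.Prime]

/-- The degree over the subfield of `p`-th powers is invariant under finite extensions. -/
theorem finrank_frobenius_fieldRange (K L : Type*) [Field K] [Field L] [CharP K p] [CharP L p]
    [Algebra K L] [FiniteDimensional K L] :
    Module.finrank (frobenius L p).fieldRange L = Module.finrank (frobenius K p).fieldRange K := by
  have hd : (algebraMap K L).fieldRange.relfinrank ⊤ = Module.finrank K L :=
    (Subfield.relfinrank_top_right _).trans (IntermediateField.finrank_bot' (F := K) (E := L))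
  have hfrob : (algebraMap K L).fieldRange.map (frobenius L p) =
      (frobenius K p).fieldRange.map (algebraMap K L) := by
    rw [RingHom.map_fieldRange, RingHom.map_fieldRange, ← RingHom.frobenius_comm]
  have h1 : ((algebraMap K L).fieldRange.map (frobenius L p)).relfinrank
      (algebraMap K L).fieldRange = Module.finrank (frobenius K p).fieldRange K := by
    rw [hfrob, RingHom.fieldRange_eq_map (algebraMap K L), Subfield.relfinrank_map_map,
      Subfield.relfinrank_top_right]
  have h2 : ((algebraMap K L).fieldRange.map (frobenius L p)).relfinrank
      (frobenius L p).fieldRange = Module.finrank K L := by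
    rw [RingHom.fieldRange_eq_map (frobenius L p), Subfield.relfinrank_map_map, hd]
  have h3 := Subfield.relfinrank_mul_relfinrank
    (A := (algebraMap K L).fieldRange.map (frobenius L p)) (B := (algebraMap K L).fieldRange)
    (C := ⊤) ?_ le_top
  have h4 := Subfield.relfinrank_mul_relfinrank
    (A := (algebraMap K L).fieldRange.map (frobenius L p)) (B := (frobenius L p).fieldRange)
    (C := ⊤) ?_ le_top
  · rw [h1, hd] at h3
    rw [h2, ← h3, Subfield.relfinrank_top_right, mul_comm] at h4
    exact Nat.eq_of_mul_eq_mul_right Module.finrank_pos h4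
  · rw [RingHom.fieldRange_eq_map (frobenius L p)]
    exact (Subfield.gc_map_comap _).monotone_l le_top
  · rw [hfrob, RingHom.fieldRange_eq_map (algebraMap K L)]
    exact (Subfield.gc_map_comap _).monotone_l le_top

variable {p}

/-- More than `δ` elements of a field of `p`-degree `δ` are `p`-dependent. -/
theorem exists_mem_pClosure {M : Type*} [Field M] [CharP M p] {δ q : ℕ} (hq : δ ≤ q)
    (hδ : Module.finrank (frobenius M p).fieldRange M = p ^ δ) {x : M}
    (hx : x ∉ (frobenius M p).fieldRange) (a : Fin q → M) :
    ∃ j, a j ∈ pClosure p (insert x (a '' Set.Iio j)) := by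
  have hp := (Fact.out : p.Prime)
  by_contra! h
  have hle (S : Set M) : (frobenius M p).fieldRange ≤ pClosure p S :=
    pClosure_empty (p := p) (F := M) ▸ pClosure_mono (Set.empty_subset S)
  have key (k : ℕ) (hk : k ≤ q) : p ^ (k + 1) ∣ (frobenius M p).fieldRange.relfinrank
      (pClosure p (insert x (a '' {i | i.val < k}))) := by
    induction k with
    | zero =>
      refine Subfield.pow_succ_dvd_relfinrank hp hδ le_rfl (hle _) (fun h => hx (h ?_)) (by simp)
      exact subset_pClosure _ (Set.mem_insert _ _)
    | succ k ih =>
      refine Subfield.pow_succ_dvd_relfinrank hp hδ (hle _) (pClosure_mono ?_) (fun h' => ?_)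
        (ih (by lia))
      · exact Set.insert_subset_insert
          (Set.image_mono fun i (hi : i.val < k) => hi.trans k.lt_succ_self)
      · refine h ⟨k, hk⟩ (h' (subset_pClosure _ (Or.inr ⟨⟨k, hk⟩, k.lt_succ_self, rfl⟩)))
  have := (key q le_rfl).trans (Subfield.relfinrank_dvd_finrank_top_of_le (hle _))
  rw [hδ] at this
  have := (Nat.pow_dvd_pow_iff_le_right hp.one_lt).1 this
  lia

end PDegree

theorem MilnorK.map_comp {F F' F'' : Type*} [Field F] [Field F'] [Field F''] (φ : F →+* F')
    (ψ : F' →+* F'') {q : ℕ} (x : MilnorK F q) :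
    MilnorK.map (ψ.comp φ) q x = MilnorK.map ψ q (MilnorK.map φ q x) := by
  suffices MilnorK.map (ψ.comp φ) q = (MilnorK.map ψ q).comp (MilnorK.map φ q) from
    DFunLike.congr_fun this x
  refine QuotientAddGroup.addMonoidHom_ext _ ?_
  refine AddMonoidHom.toIntLinearMap_injective
    (PiTensorProduct.ext (MultilinearMap.ext fun a => ?_))
  refine (map_tprod _ a).trans (.symm ?_)
  exact (congrArg (MilnorK.map ψ q) (map_tprod φ a)).trans (map_tprod ψ _)

section Restriction

variable {p : ℕ} [Fact p.Prime] {δ q : ℕ}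

theorem MilnorKMod.map_eq_zero (hq : δ ≤ q) {M M' : Type*} [Field M] [Field M'] [CharP M p]
    [CharP M' p] (hδ : Module.finrank (frobenius M p).fieldRange M = p ^ δ) (ι : M →+* M') {x : M}
    (hx : x ∉ (frobenius M p).fieldRange) (hx' : ι x ∈ (frobenius M' p).fieldRange) :
    MilnorKMod.map p ι q = 0 := by
  refine MilnorKMod.addHom_ext fun a => ?_
  rw [← symbol_eq_symbolMultilinear, map_symbol]
  obtain ⟨j, hj⟩ := exists_mem_pClosure hq hδ hx fun i => ((a i).toMul : M)
  refine symbol_eq_zero_of_mem_pClosure p _ q M' _ (Finset.Iio j) j le_rfl (by simp)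
    ((pClosure_le.2 ⟨pow_mem_pClosure _, ?_⟩) (map_mem_pClosure ι hj))
  rintro _ ⟨y, rfl | ⟨i, hi, rfl⟩, rfl⟩
  · obtain ⟨y, hy⟩ := hx'
    exact hy ▸ pow_mem_pClosure _ y
  · exact subset_pClosure _ ⟨i, by simpa using hi, rfl⟩

theorem MilnorK.exists_map_eq_nsmul (hq : δ ≤ q) {M M' : Type*} [Field M] [Field M'] [CharP M p]
    [CharP M' p] (hδ : Module.finrank (frobenius M p).fieldRange M = p ^ δ) (ι : M →+* M') {x : M}
    (hx : x ∉ (frobenius M p).fieldRange) (hx' : ι x ∈ (frobenius M' p).fieldRange)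
    (α : MilnorK M q) : ∃ γ, MilnorK.map ι q α = p • γ := by
  rw [← MilnorKMod.mk_eq_zero_iff, ← MilnorKMod.map_mk, MilnorKMod.map_eq_zero hq hδ ι hx hx',
    AddMonoidHom.zero_apply]

theorem exists_pow_mem_of_ne_top {K L : Type*} [Field K] [Field L] [CharP K p] [Algebra K L]
    [IsPurelyInseparable K L] {M : IntermediateField K L} (hM : M ≠ ⊤) :
    ∃ y ∉ M, y ^ p ∈ M := by
  obtain ⟨y, -, hy⟩ := SetLike.exists_of_lt hM.lt_top
  have h : ∃ n, y ^ p ^ n ∈ M := by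
    have := ExpChar.prime (R := K) (Fact.out : p.Prime)
    obtain ⟨n, x, hx⟩ := IsPurelyInseparable.pow_mem K p y
    exact ⟨n, hx ▸ M.algebraMap_mem x⟩
  classical
  obtain ⟨n, hn⟩ : ∃ n, Nat.find h = n + 1 := Nat.exists_eq_succ_of_ne_zero fun h0 =>
    hy (by simpa [h0] using Nat.find_spec h)
  refine ⟨y ^ p ^ n, Nat.find_min h (by lia), ?_⟩
  rw [← pow_mul, ← pow_succ, ← hn]
  exact Nat.find_spec h

/-- Restriction to a finite purely inseparable extension is divisible by the degree in degrees at
least the `p`-degree. -/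
theorem MilnorK.exists_map_algebraMap_eq_finrank_nsmul (hq : δ ≤ q) (K L : Type*) [Field K]
    [Field L] [CharP K p] [Algebra K L] [FiniteDimensional K L] [IsPurelyInseparable K L]
    (hδ : Module.finrank (frobenius K p).fieldRange K = p ^ δ) (α : MilnorK K q) :
    ∃ γ, MilnorK.map (algebraMap K L) q α = Module.finrank K L • γ := by
  have hp := (Fact.out : p.Prime)
  have : CharP L p := charP_of_injective_algebraMap (algebraMap K L).injective p
  let P (M : IntermediateField K L) : Prop :=
    ∃ γ, MilnorK.map (algebraMap K M) q α = Module.finrank K M • γ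
  have hbot : P ⊥ := ⟨_, by rw [IntermediateField.finrank_bot, one_smul]⟩
  obtain ⟨M, hPM, hmax⟩ := (InvImage.wf (fun M : IntermediateField K L =>
    Subalgebra.toSubmodule M.toSubalgebra) wellFounded_gt).has_min {M | P M} ⟨⊥, hbot⟩
  obtain ⟨γ, hγ⟩ := hPM
  obtain rfl : M = ⊤ := by
    by_contra hM
    obtain ⟨y, hyM, hy⟩ := exists_pow_mem_of_ne_top (p := p) hM
    have : CharP M p := charP_of_injective_algebraMap (algebraMap K M).injective p
    have hpow (b : M) : b ^ p ≠ ⟨y ^ p, hy⟩ := fun hb => hyM <|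
      frobenius_inj L p (congrArg Subtype.val hb : (b : L) ^ p = y ^ p) ▸ b.2
    obtain ⟨M', hM'⟩ : ∃ M', M' = IntermediateField.adjoin M {y} := ⟨_, rfl⟩
    have hyM' : y ∈ M' := hM' ▸ IntermediateField.mem_adjoin_simple_self M y
    have hfin : Module.finrank M M' = p := by
      have hmin := minpoly.eq_of_irreducible_of_monic (x := y)
        (X_pow_sub_C_irreducible_of_prime hp hpow)
        (by rw [map_sub, map_pow, aeval_X, aeval_C]; exact sub_self (y ^ p))
        (monic_X_pow_sub_C _ hp.ne_zero)
      rw [hM', IntermediateField.adjoin.finrank (IsIntegral.of_finite M y), ← hmin,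
        natDegree_X_pow_sub_C]
    have : CharP M' p := charP_of_injective_algebraMap (algebraMap M M').injective p
    obtain ⟨γ', hγ'⟩ := MilnorK.exists_map_eq_nsmul hq
      ((finrank_frobenius_fieldRange p K M).trans hδ) (algebraMap M M') (x := ⟨y ^ p, hy⟩)
      (fun ⟨b, hb⟩ => hpow b hb) ⟨⟨y, hyM'⟩, rfl⟩ γ
    refine hmax (M'.restrictScalars K) ⟨γ', ?_⟩ (SetLike.lt_iff_le_and_exists.2
      ⟨fun z hz => M'.algebraMap_mem ⟨z, hz⟩, y, hyM', hyM⟩)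
    change MilnorK.map ((algebraMap M M').comp (algebraMap K M)) q α = Module.finrank K M' • γ'
    rw [MilnorK.map_comp, hγ, map_nsmul, hγ', ← Module.finrank_mul_finrank K M M', hfin, mul_smul]
  refine ⟨MilnorK.map (algebraMap (⊤ : IntermediateField K L) L) q γ, ?_⟩
  rw [IsScalarTower.algebraMap_eq K (⊤ : IntermediateField K L) L, MilnorK.map_comp, hγ, map_nsmul,
    IntermediateField.finrank_top']

end Restriction

/-- Let `K` be a field of characteristic `p` with `[K : Kᵖ] = p^δ`.  Then
for every finite purely inseparable extension `L/K` and every `q ≥ δ`, the Milnor K-theory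
norm map `N_{L/K} : K_q^M(L) → K_q^M(K)` is surjective.  The norm map is taken as data,
characterised (uniquely, since restriction is injective) by `N ∘ res = [L:K] • ·`; the
`p`-torsion-freeness of the Milnor K-groups (Geisser–Levine) is taken as a hypothesis. -/
theorem milnorK_norm_surjective_of_purelyInseparable
    (p : ℕ) [Fact p.Prime] (δ q : ℕ) (hq : δ ≤ q)
    (K L : Type*) [Field K] [Field L] [CharP K p] [Algebra K L]
    [FiniteDimensional K L] [IsPurelyInseparable K L]
    (hpdeg : Module.finrank (frobenius K p).fieldRange K = p ^ δ)
    (htfK : ∀ α : MilnorK K q, p • α = 0 → α = 0)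
    (htfL : ∀ α : MilnorK L q, p • α = 0 → α = 0)
    (N : MilnorK L q →+ MilnorK K q)
    (hN : ∀ β : MilnorK K q,
      N (MilnorK.map (algebraMap K L) q β) = (Module.finrank K L) • β) :
    Function.Surjective N := by
  intro α
  obtain ⟨γ, hγ⟩ := MilnorK.exists_map_algebraMap_eq_finrank_nsmul hq K L hpdeg α
  have h := hN α
  rw [hγ, map_nsmul] at h
  have := ExpChar.prime (R := K) (Fact.out : p.Prime)
  obtain ⟨n, hn⟩ := IsPurelyInseparable.finrank_eq_pow K L p
  have htf (n : ℕ) (x : MilnorK K q) (hx : p ^ n • x = 0) : x = 0 := by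
    induction n with
    | zero => simpa using hx
    | succ n ih => exact ih (htfK _ (by rwa [← mul_smul, ← pow_succ']))
  refine ⟨γ, sub_eq_zero.1 (htf n _ ?_)⟩
  rw [smul_sub, ← hn, h, sub_self]
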